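/- arXiv:2501.17019 — 7 statements merged into one kernel-verified Lean document; each statement's English description precedes it below -/
import Mathlib

section
/- The approximation error E : C(Ω₁; ℂ) × L²(Ω₀, μ) → ℝ is continuous, is convex in each variable separately, and is Fréchet differentiable as a function on the product of real Banach spaces, with derivative dE_{(v,m)}(Δv, Δm) = Re ∫_{Ω₀} conj(v(α·ξ) − m(ξ)·v(ξ)) · (Δv(α·ξ) − m(ξ)·Δv(ξ) − v(ξ)·Δm(ξ)) dμ(ξ) for all Δv ∈ C(Ω₁; ℂ) and Δm ∈ L²(Ω₀, μ). -/
open MeasureTheory Set Pointwise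
open scoped Classical

noncomputable section

variable {d : ℕ} {α : ℝ} {Ω₀ : Set (EuclideanSpace ℝ (Fin d))}

/-- Evaluation of `v : C(Ω₀ ∪ α • Ω₀, ℂ)` at a point of `Ω₀` (junk value `0` off `Ω₀`). -/
def vLow (v : C(↥(Ω₀ ∪ α • Ω₀), ℂ)) (ξ : EuclideanSpace ℝ (Fin d)) : ℂ :=
  if h : ξ ∈ Ω₀ then v ⟨ξ, Or.inl h⟩ else 0

/-- Evaluation of `v : C(Ω₀ ∪ α • Ω₀, ℂ)` at `α • ξ` for `ξ ∈ Ω₀` (junk value `0` off `Ω₀`). -/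
def vHigh (v : C(↥(Ω₀ ∪ α • Ω₀), ℂ)) (ξ : EuclideanSpace ℝ (Fin d)) : ℂ :=
  if h : ξ ∈ Ω₀ then v ⟨α • ξ, Or.inr (smul_mem_smul_set h)⟩ else 0

/-- The approximation error `E(v, m) = (1/2) ∫_{Ω₀} |v(αξ) - m(ξ) v(ξ)|² dμ(ξ)`. -/
def Eapp (μ : Measure (EuclideanSpace ℝ (Fin d)))
    (v : C(↥(Ω₀ ∪ α • Ω₀), ℂ)) (m : Lp ℂ 2 (μ.restrict Ω₀)) : ℝ :=
  (1 / 2) * ∫ ξ in Ω₀, ‖vHigh v ξ - m ξ * vLow v ξ‖ ^ 2 ∂μ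

/-- A linear family of measurable functions bounded by the norm of the parameter defines a
continuous linear map into `Lp`. -/
lemma exists_clm_toLp {X V : Type*} [MeasurableSpace X] {ν : Measure X} [IsFiniteMeasure ν]
    [NormedAddCommGroup V] [NormedSpace ℝ V] (p : ENNReal) [Fact (1 ≤ p)] (e : V →ₗ[ℝ] X → ℂ)
    (hmeas : ∀ v, AEStronglyMeasurable (e v) ν) (hbound : ∀ v x, ‖e v x‖ ≤ ‖v‖) :
    ∃ T : V →L[ℝ] Lp ℂ p ν, ∀ v, T v =ᵐ[ν] e v := by
  have hLp (v : V) : MemLp (e v) p ν := .of_bound (hmeas v) ‖v‖ (.of_forall (hbound v))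
  let T : V →ₗ[ℝ] Lp ℂ p ν :=
    { toFun := fun v => (hLp v).toLp (e v)
      map_add' := fun v w => by
        rw [← MemLp.toLp_add (hLp v) (hLp w)]
        exact MemLp.toLp_congr _ _ (by simp)
      map_smul' := fun c v => by
        rw [RingHom.id_apply, ← MemLp.toLp_const_smul c (hLp v)]
        exact MemLp.toLp_congr _ _ (by simp) }
  refine ⟨T.mkContinuous (measureUnivNNReal ν ^ p.toReal⁻¹) fun v => ?_, fun v =>
    (hLp v).coeFn_toLp⟩
  refine Lp.norm_le_of_ae_bound (norm_nonneg v) ?_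
  filter_upwards [(hLp v).coeFn_toLp] with x hx
  exact hx ▸ hbound v x

/-- Pulling back along a continuous map defined on a measurable set `s`, and extending by zero,
is a continuous linear map from continuous functions to `Lp`. -/
lemma exists_clm_toLp_pullback {X K : Type*} [TopologicalSpace X] [MeasurableSpace X]
    [OpensMeasurableSpace X] [SecondCountableTopology X]
    [TopologicalSpace K] [CompactSpace K] {s : Set X} (hs : MeasurableSet s) (ν : Measure X)
    [IsFiniteMeasure ν] (p : ENNReal) [Fact (1 ≤ p)] {φ : s → K} (hφ : Continuous φ) :
    ∃ T : C(K, ℂ) →L[ℝ] Lp ℂ p (ν.restrict s),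
      ∀ v, T v =ᵐ[ν.restrict s] fun x => if h : x ∈ s then v (φ ⟨x, h⟩) else 0 := by
  refine exists_clm_toLp p
    { toFun := fun (v : C(K, ℂ)) x => if h : x ∈ s then v (φ ⟨x, h⟩) else 0
      map_add' := fun v w => by ext x; by_cases h : x ∈ s <;> simp [h]
      map_smul' := fun c v => by ext x; by_cases h : x ∈ s <;> simp [h] } ?_ ?_
  · intro v
    refine ContinuousOn.aestronglyMeasurable ?_ hs
    rw [continuousOn_iff_continuous_domRestrict]
    refine (v.continuous.comp hφ).congr fun x => ?_
    simp
  · intro v x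
    by_cases h : x ∈ s
    · simpa [h] using v.norm_coe_le_norm _
    · simp [h]

lemma convexOn_half_norm_sq {H : Type*} [NormedAddCommGroup H] [NormedSpace ℝ H] :
    ConvexOn ℝ Set.univ fun x : H => (1 / 2 : ℝ) * ‖x‖ ^ 2 :=
  (convexOn_univ_norm.pow (fun _ _ => norm_nonneg _) 2).smul (by norm_num)

section BilinearResidual

variable {V Y H : Type*} [NormedAddCommGroup V] [NormedSpace ℝ V] [NormedAddCommGroup Y]
  [NormedSpace ℝ Y] [NormedAddCommGroup H] [InnerProductSpace ℝ H]
  (T : V →L[ℝ] H) (S : V →L[ℝ] Y) (B : H →L[ℝ] Y →L[ℝ] H)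

lemma convexOn_half_norm_sq_residual_left (m : H) :
    ConvexOn ℝ Set.univ fun v : V => (1 / 2 : ℝ) * ‖T v - B m (S v)‖ ^ 2 :=
  convexOn_half_norm_sq.comp_linearMap (T - (B m).comp S).toLinearMap

lemma convexOn_half_norm_sq_residual_right (v : V) :
    ConvexOn ℝ Set.univ fun m : H => (1 / 2 : ℝ) * ‖T v - B m (S v)‖ ^ 2 :=
  convexOn_half_norm_sq.comp_affineMap
    (AffineMap.const ℝ H (T v) - (B.flip (S v)).toLinearMap.toAffineMap)

lemma exists_hasFDerivAt_half_norm_sq_residual (v : V) (m : H) :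
    ∃ L : V × H →L[ℝ] ℝ,
      HasFDerivAt (fun p : V × H => (1 / 2 : ℝ) * ‖T p.1 - B p.2 (S p.1)‖ ^ 2) L (v, m) ∧
      ∀ Δv Δm, L (Δv, Δm) =
        inner ℝ (T v - B m (S v)) (T Δv - B m (S Δv) - B Δm (S v)) := by
  have hT : HasFDerivAt (fun p : V × H => T p.1) (T.comp (.fst ℝ V H)) (v, m) :=
    (T.comp (.fst ℝ V H)).hasFDerivAt
  have hS : HasFDerivAt (fun p : V × H => S p.1) (S.comp (.fst ℝ V H)) (v, m) :=
    (S.comp (.fst ℝ V H)).hasFDerivAt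
  have hB := B.hasFDerivAt_of_bilinear (hasFDerivAt_snd (𝕜 := ℝ) (p := (v, m))) hS
  refine ⟨_, ((hT.sub hB).norm_sq.const_mul (1 / 2 : ℝ)), fun Δv Δm => ?_⟩
  simp [inner_sub_left, inner_sub_right]
  ring

end BilinearResidual

lemma Eapp_eq_half_norm_sq {μ : Measure (EuclideanSpace ℝ (Fin d))}
    {v : C(↥(Ω₀ ∪ α • Ω₀), ℂ)} {m F : Lp ℂ 2 (μ.restrict Ω₀)}
    (hF : F =ᵐ[μ.restrict Ω₀] fun ξ => vHigh v ξ - m ξ * vLow v ξ) :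
    Eapp μ v m = (1 / 2 : ℝ) * ‖F‖ ^ 2 := by
  rw [Eapp, ← real_inner_self_eq_norm_sq, L2.inner_def]
  congr 1
  refine integral_congr_ae ?_
  filter_upwards [hF] with ξ hξ
  rw [real_inner_self_eq_norm_sq, hξ]

lemma L2_real_inner_eq_re_integral {X : Type*} [MeasurableSpace X] {ν : Measure X}
    (f g : Lp ℂ 2 ν) :
    inner ℝ f g = (∫ x, (starRingEnd ℂ) (f x) * g x ∂ν).re := by
  have hint : Integrable (fun x => (starRingEnd ℂ) (f x) * g x) ν := by
    simpa [mul_comm] using L2.integrable_inner (𝕜 := ℂ) f g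
  rw [L2.inner_def]
  simp_rw [Complex.inner, mul_comm (g _)]
  exact integral_re hint

/-- The approximation error is continuous, separately convex, and Fréchet
differentiable with the stated derivative. -/
theorem stmt0 (hd : 1 ≤ d) (hα : 1 < α) (hΩ₀ : IsCompact Ω₀)
    [CompactSpace ↥(Ω₀ ∪ α • Ω₀)]
    (μ : Measure (EuclideanSpace ℝ (Fin d))) [IsFiniteMeasure μ] :
    Continuous (fun p : C(↥(Ω₀ ∪ α • Ω₀), ℂ) × Lp ℂ 2 (μ.restrict Ω₀) => Eapp μ p.1 p.2) ∧
    (∀ m : Lp ℂ 2 (μ.restrict Ω₀),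
      ConvexOn ℝ Set.univ fun v : C(↥(Ω₀ ∪ α • Ω₀), ℂ) => Eapp μ v m) ∧
    (∀ v : C(↥(Ω₀ ∪ α • Ω₀), ℂ),
      ConvexOn ℝ Set.univ fun m : Lp ℂ 2 (μ.restrict Ω₀) => Eapp μ v m) ∧
    (∀ (v : C(↥(Ω₀ ∪ α • Ω₀), ℂ)) (m : Lp ℂ 2 (μ.restrict Ω₀)),
      ∃ L : (C(↥(Ω₀ ∪ α • Ω₀), ℂ) × Lp ℂ 2 (μ.restrict Ω₀)) →L[ℝ] ℝ,
        HasFDerivAt (fun p : C(↥(Ω₀ ∪ α • Ω₀), ℂ) × Lp ℂ 2 (μ.restrict Ω₀) =>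
            Eapp μ p.1 p.2) L (v, m) ∧
        ∀ (Δv : C(↥(Ω₀ ∪ α • Ω₀), ℂ)) (Δm : Lp ℂ 2 (μ.restrict Ω₀)),
          L (Δv, Δm) =
            (∫ ξ in Ω₀, (starRingEnd ℂ) (vHigh v ξ - m ξ * vLow v ξ) *
              (vHigh Δv ξ - m ξ * vLow Δv ξ - vLow v ξ * Δm ξ) ∂μ).re) := by
  have hmeas : MeasurableSet Ω₀ := hΩ₀.isClosed.measurableSet
  obtain ⟨T, hT⟩ : ∃ T : C(↥(Ω₀ ∪ α • Ω₀), ℂ) →L[ℝ] Lp ℂ 2 (μ.restrict Ω₀),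
      ∀ v, T v =ᵐ[μ.restrict Ω₀] vHigh v :=
    exists_clm_toLp_pullback hmeas μ 2
      (φ := fun ξ : Ω₀ => (⟨α • ξ.1, Or.inr (smul_mem_smul_set ξ.2)⟩ : ↥(Ω₀ ∪ α • Ω₀)))
      (by fun_prop)
  obtain ⟨S, hS⟩ : ∃ S : C(↥(Ω₀ ∪ α • Ω₀), ℂ) →L[ℝ] Lp ℂ ⊤ (μ.restrict Ω₀),
      ∀ v, S v =ᵐ[μ.restrict Ω₀] vLow v :=
    exists_clm_toLp_pullback hmeas μ ⊤
      (φ := fun ξ : Ω₀ => (⟨ξ, Or.inl ξ.2⟩ : ↥(Ω₀ ∪ α • Ω₀))) (by fun_prop)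
  let B : Lp ℂ 2 (μ.restrict Ω₀) →L[ℝ] Lp ℂ ⊤ (μ.restrict Ω₀) →L[ℝ] Lp ℂ 2 (μ.restrict Ω₀) :=
    (ContinuousLinearMap.mul ℝ ℂ).holderL (μ.restrict Ω₀) 2 ⊤ 2
  have hB (m : Lp ℂ 2 (μ.restrict Ω₀)) (v : C(↥(Ω₀ ∪ α • Ω₀), ℂ)) :
      B m (S v) =ᵐ[μ.restrict Ω₀] fun ξ => m ξ * vLow v ξ := by
    filter_upwards [(ContinuousLinearMap.mul ℝ ℂ).coeFn_holder (r := 2) m (S v), hS v]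
      with ξ h₁ h₂
    rw [← h₂]
    exact h₁
  have hres (v : C(↥(Ω₀ ∪ α • Ω₀), ℂ)) (m : Lp ℂ 2 (μ.restrict Ω₀)) :
      ⇑(T v - B m (S v)) =ᵐ[μ.restrict Ω₀] fun ξ => vHigh v ξ - m ξ * vLow v ξ := by
    filter_upwards [Lp.coeFn_sub (T v) (B m (S v)), hT v, hB m v] with ξ h₁ h₂ h₃
    rw [h₁, Pi.sub_apply, h₂, h₃]
  have hE (v : C(↥(Ω₀ ∪ α • Ω₀), ℂ)) (m : Lp ℂ 2 (μ.restrict Ω₀)) :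
      Eapp μ v m = (1 / 2 : ℝ) * ‖T v - B m (S v)‖ ^ 2 := Eapp_eq_half_norm_sq (hres v m)
  simp_rw [hE]
  refine ⟨by fun_prop, convexOn_half_norm_sq_residual_left T S B,
    convexOn_half_norm_sq_residual_right T S B, fun v m => ?_⟩
  obtain ⟨L, hL, hL'⟩ := exists_hasFDerivAt_half_norm_sq_residual T S B v m
  refine ⟨L, hL, fun Δv Δm => ?_⟩
  rw [hL', L2_real_inner_eq_re_integral]
  congr 1
  refine integral_congr_ae ?_
  filter_upwards [hres v m, hres Δv m, hB Δm v,
    Lp.coeFn_sub (T Δv - B m (S Δv)) (B Δm (S v))] with ξ h₁ h₂ h₃ h₄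
  rw [h₁, h₄, Pi.sub_apply, h₂, h₃, mul_comm (vLow v ξ)]
end
end

section
/- Suppose Ω₀ equals the closure of its interior and there exists a point ξ₀ ∈ Ω₀ with v(ξ₀) = 0 for every v ∈ S. Then E_wc : L^∞(Ω₀, μ) → ℝ is not coercive — there is a sequence (m_k) in L^∞(Ω₀, μ) with ‖m_k‖_{L^∞} → ∞ and sup_k E_wc(m_k) < ∞ — and moreover there exists a minimizing sequence for E_wc (i.e., with E_wc(m_k) → inf_{m ∈ L^∞(Ω₀, μ)} E_wc(m)) satisfying ‖m_k‖_{L^∞} → ∞. -/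
open MeasureTheory Set Pointwise Filter Topology
open scoped Classical ENNReal

noncomputable section

variable {d : ℕ} {α : ℝ} {Ω₀ : Set (EuclideanSpace ℝ (Fin d))}

/-- The approximation error, with `m ∈ L^∞(Ω₀, μ)`. -/
def EappTop (μ : Measure (EuclideanSpace ℝ (Fin d)))
    (v : C(↥(Ω₀ ∪ α • Ω₀), ℂ)) (m : Lp ℂ ⊤ (μ.restrict Ω₀)) : ℝ :=
  (1 / 2) * ∫ ξ in Ω₀, ‖vHigh v ξ - m ξ * vLow v ξ‖ ^ 2 ∂μ

/-- The worst-case error over `S`, on `L^∞(Ω₀, μ)`. -/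
def EwcTop (μ : Measure (EuclideanSpace ℝ (Fin d))) (S : Set C(↥(Ω₀ ∪ α • Ω₀), ℂ))
    (m : Lp ℂ ⊤ (μ.restrict Ω₀)) : ℝ :=
  sSup ((fun v => EappTop μ v m) '' S)

theorem norm_vLow_le [CompactSpace ↥(Ω₀ ∪ α • Ω₀)] (v : C(↥(Ω₀ ∪ α • Ω₀), ℂ))
    (ξ : EuclideanSpace ℝ (Fin d)) : ‖vLow v ξ‖ ≤ ‖v‖ := by
  unfold vLow
  split_ifs with h
  · exact v.norm_coe_le_norm _
  · simp

theorem norm_vHigh_le [CompactSpace ↥(Ω₀ ∪ α • Ω₀)] (v : C(↥(Ω₀ ∪ α • Ω₀), ℂ))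
    (ξ : EuclideanSpace ℝ (Fin d)) : ‖vHigh v ξ‖ ≤ ‖v‖ := by
  unfold vHigh
  split_ifs with h
  · exact v.norm_coe_le_norm _
  · simp

theorem continuousOn_vLow (v : C(↥(Ω₀ ∪ α • Ω₀), ℂ)) : ContinuousOn (vLow v) Ω₀ := by
  rw [continuousOn_iff_continuous_domRestrict]
  have h : Ω₀.domRestrict (vLow v) = fun ξ : Ω₀ => v ⟨ξ, Or.inl ξ.2⟩ := by
    ext ξ
    simp [vLow]
  rw [h]
  fun_prop

theorem continuousOn_vHigh (v : C(↥(Ω₀ ∪ α • Ω₀), ℂ)) : ContinuousOn (vHigh v) Ω₀ := by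
  rw [continuousOn_iff_continuous_domRestrict]
  have h : Ω₀.domRestrict (vHigh v) =
      fun ξ : Ω₀ => v ⟨α • (ξ : EuclideanSpace ℝ (Fin d)), Or.inr (smul_mem_smul_set ξ.2)⟩ := by
    ext ξ
    simp [vHigh]
  rw [h]
  fun_prop

theorem ae_norm_le_norm_Lp_top {X : Type*} [MeasurableSpace X] {ν : Measure X}
    (m : Lp ℂ ⊤ ν) : ∀ᵐ x ∂ν, ‖m x‖ ≤ ‖m‖ := by
  have h : eLpNormEssSup m ν ≠ ⊤ := by
    simpa only [eLpNorm_exponent_top] using Lp.eLpNorm_ne_top m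
  filter_upwards [ae_le_eLpNormEssSup (f := m) (μ := ν)] with x hx
  rw [Lp.norm_def, eLpNorm_exponent_top]
  simpa using ENNReal.toReal_mono h hx

theorem ae_norm_residual_le [CompactSpace ↥(Ω₀ ∪ α • Ω₀)]
    (μ : Measure (EuclideanSpace ℝ (Fin d))) (v : C(↥(Ω₀ ∪ α • Ω₀), ℂ))
    (m : Lp ℂ ⊤ (μ.restrict Ω₀)) :
    ∀ᵐ ξ ∂(μ.restrict Ω₀), ‖vHigh v ξ - m ξ * vLow v ξ‖ ≤ (1 + ‖m‖) * ‖v‖ := by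
  filter_upwards [ae_norm_le_norm_Lp_top m] with ξ hξ
  calc ‖vHigh v ξ - m ξ * vLow v ξ‖ ≤ ‖vHigh v ξ‖ + ‖m ξ‖ * ‖vLow v ξ‖ := by
        rw [← norm_mul]; exact norm_sub_le _ _
    _ ≤ ‖v‖ + ‖m‖ * ‖v‖ := by
        gcongr
        · exact norm_vHigh_le v ξ
        · exact norm_vLow_le v ξ
    _ = (1 + ‖m‖) * ‖v‖ := by ring

theorem integrable_residual_sq [CompactSpace ↥(Ω₀ ∪ α • Ω₀)] (hΩ₀ : MeasurableSet Ω₀)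
    (μ : Measure (EuclideanSpace ℝ (Fin d))) [IsFiniteMeasure μ]
    (v : C(↥(Ω₀ ∪ α • Ω₀), ℂ)) (m : Lp ℂ ⊤ (μ.restrict Ω₀)) :
    Integrable (fun ξ => ‖vHigh v ξ - m ξ * vLow v ξ‖ ^ 2) (μ.restrict Ω₀) := by
  have hmeas : AEStronglyMeasurable (fun ξ => vHigh v ξ - m ξ * vLow v ξ) (μ.restrict Ω₀) :=
    ((continuousOn_vHigh v).aestronglyMeasurable hΩ₀).sub
      ((Lp.aestronglyMeasurable m).mul ((continuousOn_vLow v).aestronglyMeasurable hΩ₀))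
  refine Integrable.of_bound (hmeas.norm.pow 2) (((1 + ‖m‖) * ‖v‖) ^ 2) ?_
  filter_upwards [ae_norm_residual_le μ v m] with ξ hξ
  rw [norm_pow, norm_norm]
  gcongr

theorem EappTop_nonneg (μ : Measure (EuclideanSpace ℝ (Fin d)))
    (v : C(↥(Ω₀ ∪ α • Ω₀), ℂ)) (m : Lp ℂ ⊤ (μ.restrict Ω₀)) : 0 ≤ EappTop μ v m := by
  unfold EappTop
  positivity

theorem EwcTop_nonneg (μ : Measure (EuclideanSpace ℝ (Fin d)))
    (S : Set C(↥(Ω₀ ∪ α • Ω₀), ℂ)) (m : Lp ℂ ⊤ (μ.restrict Ω₀)) : 0 ≤ EwcTop μ S m := by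
  refine Real.sSup_nonneg ?_
  rintro _ ⟨v, -, rfl⟩
  exact EappTop_nonneg μ v m

theorem bddAbove_EappTop_image [CompactSpace ↥(Ω₀ ∪ α • Ω₀)]
    (μ : Measure (EuclideanSpace ℝ (Fin d))) [IsFiniteMeasure μ]
    {S : Set C(↥(Ω₀ ∪ α • Ω₀), ℂ)} {B : ℝ} (hB : ∀ v ∈ S, ‖v‖ ≤ B)
    (m : Lp ℂ ⊤ (μ.restrict Ω₀)) : BddAbove ((fun v => EappTop μ v m) '' S) := by
  refine ⟨1 / 2 * ∫ _ in Ω₀, ((1 + ‖m‖) * B) ^ 2 ∂μ, ?_⟩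
  rintro _ ⟨v, hv, rfl⟩
  refine mul_le_mul_of_nonneg_left ?_ (by norm_num)
  refine integral_mono_of_nonneg (ae_of_all _ fun ξ => by positivity) (integrable_const _) ?_
  filter_upwards [ae_norm_residual_le μ v m] with ξ hξ
  have := hB v hv
  refine pow_le_pow_left₀ (norm_nonneg _) (hξ.trans ?_) 2
  gcongr

/-- Perturbing `m` on a set `U` changes the error by at most a multiple of `μ U`. -/
theorem EappTop_add_indicatorConstLp_le [CompactSpace ↥(Ω₀ ∪ α • Ω₀)] (hΩ₀ : MeasurableSet Ω₀)
    (μ : Measure (EuclideanSpace ℝ (Fin d))) [IsFiniteMeasure μ]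
    (v : C(↥(Ω₀ ∪ α • Ω₀), ℂ)) {B : ℝ} (hB : ‖v‖ ≤ B) (m : Lp ℂ ⊤ (μ.restrict Ω₀))
    {U : Set (EuclideanSpace ℝ (Fin d))} (hU : MeasurableSet U)
    (hμU : μ.restrict Ω₀ U ≠ ⊤) (c : ℂ) :
    EappTop μ v (m + indicatorConstLp ⊤ hU hμU c) ≤
      EappTop μ v m + ((1 + ‖m‖ + ‖c‖) * B) ^ 2 * (μ.restrict Ω₀).real U := by
  set C : ℝ := ((1 + ‖m‖ + ‖c‖) * B) ^ 2
  have hint := integrable_residual_sq hΩ₀ μ v m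
  have hind : Integrable (U.indicator fun _ => C) (μ.restrict Ω₀) :=
    (integrable_const C).indicator hU
  have key : ∫ ξ in Ω₀, ‖vHigh v ξ - (m + indicatorConstLp ⊤ hU hμU c :
      Lp ℂ ⊤ (μ.restrict Ω₀)) ξ * vLow v ξ‖ ^ 2 ∂μ ≤
      ∫ ξ in Ω₀, (‖vHigh v ξ - m ξ * vLow v ξ‖ ^ 2 + U.indicator (fun _ => C) ξ) ∂μ := by
    refine integral_mono_of_nonneg (ae_of_all _ fun ξ => by positivity) (hint.add hind) ?_
    filter_upwards [ae_norm_residual_le μ v m, Lp.coeFn_add m (indicatorConstLp ⊤ hU hμU c),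
      indicatorConstLp_coeFn (p := ⊤) (hs := hU) (hμs := hμU) (c := c)] with ξ hξ hadd hcoe
    rw [hadd, Pi.add_apply, hcoe]
    by_cases hξU : ξ ∈ U
    · simp only [indicator_of_mem hξU]
      refine le_add_of_nonneg_of_le (by positivity) ?_
      refine pow_le_pow_left₀ (norm_nonneg _) ?_ 2
      calc ‖vHigh v ξ - (m ξ + c) * vLow v ξ‖
          = ‖(vHigh v ξ - m ξ * vLow v ξ) - c * vLow v ξ‖ := by congr 1; ring
        _ ≤ (1 + ‖m‖) * ‖v‖ + ‖c‖ * ‖v‖ := by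
            refine (norm_sub_le _ _).trans (add_le_add hξ ?_)
            rw [norm_mul]
            gcongr
            exact norm_vLow_le v ξ
        _ = (1 + ‖m‖ + ‖c‖) * ‖v‖ := by ring
        _ ≤ (1 + ‖m‖ + ‖c‖) * B := by gcongr
    · simp [indicator_of_notMem hξU]
  rw [integral_add hint hind, integral_indicator_const _ hU, smul_eq_mul] at key
  have hpos : 0 ≤ (μ.restrict Ω₀).real U * C := by positivity
  unfold EappTop
  linarith

/-- A nonempty open set contains open subsets of positive and arbitrarily small measure,
provided `μ` dominates a multiple of Lebesgue measure there and does not charge points. -/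
theorem exists_isOpen_measure_pos_lt (hd : 1 ≤ d)
    (μ : Measure (EuclideanSpace ℝ (Fin d))) [IsFiniteMeasure μ]
    {cμ Cμ : ℝ≥0∞} (hcμ : 0 < cμ)
    (hcomp : ∀ A : Set (EuclideanSpace ℝ (Fin d)), MeasurableSet A → A ⊆ Ω₀ →
      cμ * volume A ≤ μ A ∧ μ A ≤ Cμ * volume A)
    (hne : (interior Ω₀).Nonempty) {δ : ℝ≥0∞} (hδ : 0 < δ) :
    ∃ U ⊆ Ω₀, IsOpen U ∧ 0 < μ U ∧ μ U < δ := by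
  obtain ⟨x, hx⟩ := hne
  have : Nonempty (Fin d) := ⟨⟨0, hd⟩⟩
  have hx0 : μ {x} < δ := by
    refine lt_of_le_of_lt ?_ hδ
    simpa using (hcomp {x} (measurableSet_singleton x)
      (singleton_subset_iff.2 (interior_subset hx))).2
  obtain ⟨V, hxV, hV, hμV⟩ := Set.exists_isOpen_lt_of_lt {x} δ hx0
  have hopen : IsOpen (V ∩ interior Ω₀) := hV.inter isOpen_interior
  have hsub : V ∩ interior Ω₀ ⊆ Ω₀ := inter_subset_right.trans interior_subset
  refine ⟨V ∩ interior Ω₀, hsub, hopen, ?_, (measure_mono inter_subset_left).trans_lt hμV⟩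
  have hvol : 0 < volume (V ∩ interior Ω₀) :=
    hopen.measure_pos volume ⟨x, hxV rfl, hx⟩
  exact (ENNReal.mul_pos hcμ.ne' hvol.ne').trans_le (hcomp _ hopen.measurableSet hsub).1

/-- Arbitrarily large multipliers are almost as good as any given one. -/
theorem exists_large_norm_EwcTop_le [CompactSpace ↥(Ω₀ ∪ α • Ω₀)] (hd : 1 ≤ d)
    (hΩ₀ : MeasurableSet Ω₀) (hne : (interior Ω₀).Nonempty)
    (μ : Measure (EuclideanSpace ℝ (Fin d))) [IsFiniteMeasure μ]
    {cμ Cμ : ℝ≥0∞} (hcμ : 0 < cμ)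
    (hcomp : ∀ A : Set (EuclideanSpace ℝ (Fin d)), MeasurableSet A → A ⊆ Ω₀ →
      cμ * volume A ≤ μ A ∧ μ A ≤ Cμ * volume A)
    {S : Set C(↥(Ω₀ ∪ α • Ω₀), ℂ)} (hSne : S.Nonempty) {B : ℝ} (hB : ∀ v ∈ S, ‖v‖ ≤ B)
    (m : Lp ℂ ⊤ (μ.restrict Ω₀)) (R : ℝ) {ε : ℝ} (hε : 0 < ε) :
    ∃ m' : Lp ℂ ⊤ (μ.restrict Ω₀), R ≤ ‖m'‖ ∧ EwcTop μ S m' ≤ EwcTop μ S m + ε := by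
  set c : ℝ := |R| + ‖m‖
  have hc : 0 ≤ c := by positivity
  set C : ℝ := ((1 + ‖m‖ + ‖(c : ℂ)‖) * B) ^ 2
  have hC : 0 ≤ C := by positivity
  obtain ⟨U, hUΩ, hUo, hU0, hUδ⟩ := exists_isOpen_measure_pos_lt hd μ hcμ hcomp hne
    (δ := ENNReal.ofReal (ε / (C + 1))) (by simp; positivity)
  have hU := hUo.measurableSet
  have hres : μ.restrict Ω₀ U = μ U := by
    rw [Measure.restrict_apply hU, inter_eq_left.2 hUΩ]
  have hμU : μ.restrict Ω₀ U ≠ ⊤ := measure_ne_top _ _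
  refine ⟨m + indicatorConstLp ⊤ hU hμU (c : ℂ), ?_, ?_⟩
  · have h1 : ‖indicatorConstLp ⊤ hU hμU (c : ℂ)‖ = c := by
      rw [norm_indicatorConstLp_top (by rw [hres]; exact hU0.ne'), Complex.norm_real,
        Real.norm_of_nonneg hc]
    have h2 := norm_le_add_norm_add' m (indicatorConstLp ⊤ hU hμU (c : ℂ))
    have h3 := le_abs_self R
    have h4 : c = |R| + ‖m‖ := rfl
    linarith
  · have hreal : C * (μ.restrict Ω₀).real U ≤ ε := by
      have h1 : (μ.restrict Ω₀).real U ≤ ε / (C + 1) := by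
        rw [measureReal_def, hres]
        exact ENNReal.toReal_le_of_le_ofReal (by positivity) hUδ.le
      calc C * (μ.restrict Ω₀).real U ≤ (C + 1) * (ε / (C + 1)) := by
            gcongr; linarith
        _ = ε := by field_simp
    refine csSup_le (hSne.image _) ?_
    rintro _ ⟨v, hv, rfl⟩
    calc EappTop μ v (m + indicatorConstLp ⊤ hU hμU (c : ℂ))
        ≤ EappTop μ v m + C * (μ.restrict Ω₀).real U :=
          EappTop_add_indicatorConstLp_le hΩ₀ μ v (hB v hv) m hU hμU c
      _ ≤ EwcTop μ S m + ε :=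
          add_le_add (le_csSup (bddAbove_EappTop_image μ hB m) ⟨v, hv, rfl⟩) hreal

/-- If `Ω₀` is the closure of its interior and the elements of `S` have a
common zero in `Ω₀`, then `E_wc : L^∞(Ω₀, μ) → ℝ` is not coercive, and there exists an
unbounded minimizing sequence. -/
theorem stmt2 (hd : 1 ≤ d) (hα : 1 < α) (hΩ₀ : IsCompact Ω₀)
    (hreg : Ω₀ = closure (interior Ω₀))
    [CompactSpace ↥(Ω₀ ∪ α • Ω₀)]
    (μ : Measure (EuclideanSpace ℝ (Fin d))) [IsFiniteMeasure μ]
    (cμ Cμ : ℝ≥0∞) (hcμ : 0 < cμ) (hcC : cμ ≤ Cμ) (hCμ : Cμ ≠ ⊤)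
    (hcomp : ∀ A : Set (EuclideanSpace ℝ (Fin d)), MeasurableSet A → A ⊆ Ω₀ →
      cμ * volume A ≤ μ A ∧ μ A ≤ Cμ * volume A)
    (S : Set C(↥(Ω₀ ∪ α • Ω₀), ℂ)) (hS : IsCompact S) (hSne : S.Nonempty)
    (hzero : ∃ ξ₀ : EuclideanSpace ℝ (Fin d), ∃ h₀ : ξ₀ ∈ Ω₀,
      ∀ v ∈ S, v ⟨ξ₀, Or.inl h₀⟩ = 0) :
    (∃ mseq : ℕ → Lp ℂ ⊤ (μ.restrict Ω₀),
      Tendsto (fun k => ‖mseq k‖) atTop atTop ∧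
      BddAbove (Set.range fun k => EwcTop μ S (mseq k))) ∧
    (∃ mseq : ℕ → Lp ℂ ⊤ (μ.restrict Ω₀),
      Tendsto (fun k => EwcTop μ S (mseq k)) atTop
        (𝓝 (⨅ m' : Lp ℂ ⊤ (μ.restrict Ω₀), EwcTop μ S m')) ∧
      Tendsto (fun k => ‖mseq k‖) atTop atTop) := by
  obtain ⟨ξ₀, h₀, -⟩ := hzero
  have hne : (interior Ω₀).Nonempty := closure_nonempty_iff.1 (hreg ▸ ⟨ξ₀, h₀⟩)
  obtain ⟨B, hB⟩ := hS.isBounded.exists_norm_le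
  have large := fun m R (ε : ℝ) (hε : 0 < ε) =>
    exists_large_norm_EwcTop_le hd hΩ₀.measurableSet hne μ hcμ hcomp hSne hB m R hε
  constructor
  · choose mseq hnorm hE using fun k : ℕ => large 0 k 1 one_pos
    refine ⟨mseq, tendsto_atTop_mono hnorm tendsto_natCast_atTop_atTop, EwcTop μ S 0 + 1, ?_⟩
    rintro _ ⟨k, rfl⟩
    exact hE k
  · have hbdd : BddBelow (range fun m' : Lp ℂ ⊤ (μ.restrict Ω₀) => EwcTop μ S m') := by
      refine ⟨0, ?_⟩
      rintro _ ⟨m, rfl⟩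
      exact EwcTop_nonneg μ S m
    have hpos : ∀ k : ℕ, (0 : ℝ) < 1 / ((k : ℝ) + 1) := fun k => by positivity
    choose m hm using fun k : ℕ => exists_lt_of_ciInf_lt
      (lt_add_of_pos_right (⨅ m' : Lp ℂ ⊤ (μ.restrict Ω₀), EwcTop μ S m') (hpos k))
    choose mseq hnorm hE using fun k : ℕ => large (m k) k _ (hpos k)
    refine ⟨mseq, ?_, tendsto_atTop_mono hnorm tendsto_natCast_atTop_atTop⟩
    have hlim : Tendsto (fun k : ℕ => (⨅ m' : Lp ℂ ⊤ (μ.restrict Ω₀), EwcTop μ S m') +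
        1 / ((k : ℝ) + 1) + 1 / ((k : ℝ) + 1)) atTop
        (𝓝 (⨅ m' : Lp ℂ ⊤ (μ.restrict Ω₀), EwcTop μ S m')) := by
      simpa using (tendsto_const_nhds.add tendsto_one_div_add_atTop_nhds_zero_nat).add
        (tendsto_one_div_add_atTop_nhds_zero_nat (𝕜 := ℝ))
    refine tendsto_of_tendsto_of_tendsto_of_le_of_le tendsto_const_nhds hlim
      (fun k => ciInf_le hbdd (mseq k)) fun k => ?_
    have h1 := hm k
    have h2 := hE k
    dsimp only
    linarith
end
end

section
/- Assume f(ξ) ≠ 0 for every ξ ∈ Ω₀, Δ > n, Δ ≥ sup{ tr X : X ∈ W }, and Σ⁰ ∈ K_Δ. Then there exists a constant C_FPI > 0, independent of δ ∈ (0, 1] and of τ_S, τ_G > 0, such that whenever τ_S + C_FPI·τ_G/δ³ < 1, the map H_map sends K_Δ into itself, is a contraction on K_Δ, has a unique fixed point in K_Δ, and the iterates Σ^{k+1} := H_map(Σ^k) starting from Σ⁰ converge to this unique fixed point. -/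
open MeasureTheory Set Pointwise Matrix Filter Topology
open scoped Classical NNReal ComplexOrder

attribute [local instance] Matrix.frobeniusNormedAddCommGroup Matrix.frobeniusNormedSpace

noncomputable section

variable {d n : ℕ} {α : ℝ} {Ω₀ : Set (EuclideanSpace ℝ (Fin d))}

def fLow (f : Fin n → C(↥(Ω₀ ∪ α • Ω₀), ℂ)) (ξ : EuclideanSpace ℝ (Fin d)) : Fin n → ℂ :=
  fun i => if h : ξ ∈ Ω₀ then f i ⟨ξ, Or.inl h⟩ else 0

def fHigh (f : Fin n → C(↥(Ω₀ ∪ α • Ω₀), ℂ)) (ξ : EuclideanSpace ℝ (Fin d)) : Fin n → ℂ :=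
  fun i => if h : ξ ∈ Ω₀ then f i ⟨α • ξ, Or.inr (smul_mem_smul_set h)⟩ else 0

/-- The Gram map applied to a pointwise-defined multiplier. -/
def gramFun (μ : Measure (EuclideanSpace ℝ (Fin d))) (f : Fin n → C(↥(Ω₀ ∪ α • Ω₀), ℂ))
    (m : EuclideanSpace ℝ (Fin d) → ℂ) : Matrix (Fin n) (Fin n) ℂ :=
  (2 : ℝ)⁻¹ • ∫ ξ in Ω₀,
    vecMulVec (fHigh f ξ - m ξ • fLow f ξ) (star (fHigh f ξ - m ξ • fLow f ξ)) ∂μ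

/-- The regularized multiplier `M_δ(Σ)`. -/
def Mreg (f : Fin n → C(↥(Ω₀ ∪ α • Ω₀), ℂ)) (δ : ℝ) (Sig : Matrix (Fin n) (Fin n) ℂ)
    (ξ : EuclideanSpace ℝ (Fin d)) : ℂ :=
  (star (fLow f ξ) ⬝ᵥ ((δ • (1 : Matrix (Fin n) (Fin n) ℂ) + Sig).mulVec (fHigh f ξ))) /
    (star (fLow f ξ) ⬝ᵥ ((δ • (1 : Matrix (Fin n) (Fin n) ℂ) + Sig).mulVec (fLow f ξ)))

/-- `K_Δ`: positive semidefinite Hermitian matrices of trace at most `Δ`. -/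
def Kset (n : ℕ) (Δ : ℝ) : Set (Matrix (Fin n) (Fin n) ℂ) :=
  {Sig | Sig.PosSemidef ∧ (Sig.trace).re ≤ Δ}

section Frobenius

lemma frobenius_norm_sq (A : Matrix (Fin n) (Fin n) ℂ) :
    ‖A‖ ^ 2 = ∑ i, ∑ j, ‖A i j‖ ^ 2 := by
  rw [frobenius_norm_def, ← Real.rpow_natCast, ← Real.rpow_mul (by positivity)]
  norm_num

/-- The real Frobenius inner product `Re tr(Aᴴ B)`, inducing the Frobenius norm. -/
abbrev frobeniusInnerProductSpace : InnerProductSpace ℝ (Matrix (Fin n) (Fin n) ℂ) :=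
  { Matrix.frobeniusNormedSpace with
    inner := fun A B => (Aᴴ * B).trace.re
    norm_sq_eq_re_inner := by
      intro A
      simp only [frobenius_norm_sq, Matrix.trace, Matrix.diag, Matrix.mul_apply,
        Matrix.conjTranspose_apply, RCLike.re_to_real, Complex.re_sum]
      rw [Finset.sum_comm]
      refine Finset.sum_congr rfl fun i _ => Finset.sum_congr rfl fun j _ => ?_
      rw [Complex.sq_norm, Complex.normSq_apply]
      simp
    conj_inner_symm := by
      intro A B
      have h : (Aᴴ * B).trace = star ((Bᴴ * A).trace) := by
        rw [← Matrix.trace_conjTranspose, Matrix.conjTranspose_mul,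
          Matrix.conjTranspose_conjTranspose]
      simp [h]
    add_left := by
      intro A B C
      simp [Matrix.add_mul]
    smul_left := by
      intro A B r
      simp [Matrix.conjTranspose_smul] }

attribute [local instance] frobeniusInnerProductSpace

lemma frobenius_inner_def (A B : Matrix (Fin n) (Fin n) ℂ) :
    inner ℝ A B = (Aᴴ * B).trace.re := rfl

lemma inner_vecMulVec_self_star_nonneg {Q : Matrix (Fin n) (Fin n) ℂ} (hQ : Q.PosSemidef)
    (v : Fin n → ℂ) : 0 ≤ inner ℝ Q (vecMulVec v (star v)) := by
  rw [frobenius_inner_def, hQ.1.eq, Matrix.mul_vecMulVec, Matrix.trace_vecMulVec, dotProduct_comm]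
  exact (Complex.le_def.1 (hQ.dotProduct_mulVec_nonneg v)).1

lemma Matrix.PosSemidef.frobenius_inner_nonneg {Q X : Matrix (Fin n) (Fin n) ℂ}
    (hQ : Q.PosSemidef) (hX : X.PosSemidef) : 0 ≤ inner ℝ Q X := by
  obtain ⟨m, v, rfl⟩ := Matrix.posSemidef_iff_eq_sum_vecMulVec.1 hX
  rw [inner_sum]
  exact Finset.sum_nonneg fun i _ => inner_vecMulVec_self_star_nonneg hQ (v i)

open scoped MatrixOrder in
lemma Matrix.PosSemidef.frobenius_norm_le_trace {X : Matrix (Fin n) (Fin n) ℂ}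
    (hX : X.PosSemidef) : ‖X‖ ≤ X.trace.re := by
  obtain ⟨B, rfl⟩ := CStarAlgebra.nonneg_iff_eq_star_mul_self.mp hX.nonneg
  rw [star_eq_conjTranspose, ← frobenius_inner_def, real_inner_self_eq_norm_sq, sq]
  exact (frobenius_norm_mul _ _).trans_eq (by rw [frobenius_norm_conjTranspose])

lemma real_inner_proj_le_zero {W : Set (Matrix (Fin n) (Fin n) ℂ)} (hW : Convex ℝ W)
    {X P : Matrix (Fin n) (Fin n) ℂ} (hP : P ∈ W) (hmin : ∀ Y ∈ W, ‖X - P‖ ≤ ‖X - Y‖) :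
    ∀ Y ∈ W, inner ℝ (X - P) (Y - P) ≤ 0 := by
  refine (norm_eq_iInf_iff_real_inner_le_zero hW hP).1 ?_
  have : Nonempty W := ⟨⟨P, hP⟩⟩
  refine le_antisymm (le_ciInf fun w => hmin w w.2) (ciInf_le ⟨0, ?_⟩ (⟨P, hP⟩ : W))
  rintro _ ⟨w, rfl⟩
  exact norm_nonneg _

/-- The nearest-point projection onto a convex set is nonexpansive. -/
lemma norm_proj_sub_proj_le {W : Set (Matrix (Fin n) (Fin n) ℂ)} (hW : Convex ℝ W)
    {proj : Matrix (Fin n) (Fin n) ℂ → Matrix (Fin n) (Fin n) ℂ}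
    (hproj : ∀ X, proj X ∈ W ∧ ∀ Y ∈ W, ‖X - proj X‖ ≤ ‖X - Y‖)
    (X Y : Matrix (Fin n) (Fin n) ℂ) : ‖proj X - proj Y‖ ≤ ‖X - Y‖ := by
  have h1 := real_inner_proj_le_zero hW (hproj X).1 (hproj X).2 _ (hproj Y).1
  have h2 := real_inner_proj_le_zero hW (hproj Y).1 (hproj Y).2 _ (hproj X).1
  have h3 : inner ℝ (X - Y) (proj X - proj Y) - ‖proj X - proj Y‖ ^ 2 =
      -(inner ℝ (X - proj X) (proj Y - proj X) + inner ℝ (Y - proj Y) (proj X - proj Y)) := by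
    rw [← real_inner_self_eq_norm_sq, ← neg_sub (proj X) (proj Y), inner_neg_right,
      ← inner_sub_left, neg_add, neg_neg, ← sub_eq_add_neg, ← inner_sub_left]
    congr 1
    abel
  have h4 := real_inner_le_norm (X - Y) (proj X - proj Y)
  by_contra! h
  have h5 := norm_nonneg (X - Y)
  nlinarith

/-- Over an orthosymmetric spectral set, the nearest point to a matrix that pairs nonnegatively
with all positive semidefinite matrices is itself positive semidefinite. -/
lemma posSemidef_of_isNearest {W : Set (Matrix (Fin n) (Fin n) ℂ)} (hW : Convex ℝ W)
    {D : Set (Fin n → ℝ)}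
    (hD : ∀ x ∈ D, ∀ s : Fin n → ℝ, (∀ i, s i = 1 ∨ s i = -1) → (fun i => s i * x i) ∈ D)
    (hWD : W = {X | ∃ U ∈ Matrix.unitaryGroup (Fin n) ℂ, ∃ dv ∈ D,
      X = U * Matrix.diagonal (fun i => (dv i : ℂ)) * star U})
    {X P : Matrix (Fin n) (Fin n) ℂ} (hP : P ∈ W) (hmin : ∀ Y ∈ W, ‖X - P‖ ≤ ‖X - Y‖)
    (hX : ∀ Q : Matrix (Fin n) (Fin n) ℂ, Q.PosSemidef → 0 ≤ inner ℝ Q X) : P.PosSemidef := by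
  obtain ⟨U, hU, x, hx, rfl⟩ : ∃ U ∈ Matrix.unitaryGroup (Fin n) ℂ, ∃ dv ∈ D,
      P = U * Matrix.diagonal (fun i => (dv i : ℂ)) * star U := by
    rw [hWD] at hP
    exact hP
  set conj : (Fin n → ℝ) → Matrix (Fin n) (Fin n) ℂ :=
    fun y => U * Matrix.diagonal (fun i => (y i : ℂ)) * star U with hconj
  have hpsd : ∀ y : Fin n → ℝ, (∀ i, 0 ≤ y i) → (conj y).PosSemidef := by
    intro y hy
    refine Matrix.PosSemidef.mul_mul_conjTranspose_same (.diagonal fun i => ?_) U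
    simpa using hy i
  have hnorm : ∀ y, ‖conj y‖ ^ 2 = ∑ i, y i ^ 2 := by
    intro y
    have hU' : star U * U = 1 := (Matrix.mem_unitaryGroup_iff').1 hU
    have hdiag : (Matrix.diagonal fun i => (y i : ℂ))ᴴ = Matrix.diagonal fun i => (y i : ℂ) := by
      rw [Matrix.diagonal_conjTranspose]
      congr 1
      ext i
      simp
    rw [← real_inner_self_eq_norm_sq, frobenius_inner_def]
    have : (conj y)ᴴ * conj y = U * (Matrix.diagonal (fun i => (y i : ℂ)) *
        Matrix.diagonal (fun i => (y i : ℂ))) * star U := by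
      simp only [hconj, star_eq_conjTranspose, Matrix.conjTranspose_mul,
        Matrix.conjTranspose_conjTranspose, hdiag] at hU' ⊢
      calc _ = U * Matrix.diagonal (fun i => (y i : ℂ)) * (Uᴴ * U) *
            Matrix.diagonal (fun i => (y i : ℂ)) * Uᴴ := by simp only [Matrix.mul_assoc]
        _ = _ := by rw [hU', Matrix.mul_one]; simp only [Matrix.mul_assoc]
    rw [this, Matrix.trace_mul_comm, ← Matrix.mul_assoc, hU', Matrix.one_mul,
      Matrix.diagonal_mul_diagonal, Matrix.trace_diagonal, Complex.re_sum]
    simp [sq]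
  have habs : conj (fun i => |x i|) ∈ W := by
    rw [hWD]
    refine ⟨U, hU, _, ?_, rfl⟩
    convert hD x hx (fun i => if 0 ≤ x i then 1 else -1) (fun i => by
      by_cases h : 0 ≤ x i <;> simp [h]) using 2 with i
    by_cases h : 0 ≤ x i
    · simp [h, abs_of_nonneg h]
    · simp [h, abs_of_neg (not_le.1 h)]
  have hle : inner ℝ X (conj x) ≤ inner ℝ X (conj fun i => |x i|) := by
    have hsub : conj (fun i => |x i|) - conj x = conj (fun i => |x i| - x i) := by
      simp only [hconj, Complex.ofReal_sub, ← Matrix.sub_mul, ← Matrix.mul_sub,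
        Matrix.diagonal_sub]
    have := hX _ (hpsd _ fun i => sub_nonneg.2 (le_abs_self (x i)))
    rw [← hsub, real_inner_comm, inner_sub_right] at this
    linarith
  have hvar := real_inner_proj_le_zero hW hP hmin _ habs
  have heq : conj x = conj fun i => |x i| := by
    have hn : ‖conj x‖ ^ 2 = ‖conj fun i => |x i|‖ ^ 2 := by simp [hnorm]
    have hexp : ‖conj x - conj fun i => |x i|‖ ^ 2 =
        ‖conj x‖ ^ 2 - 2 * inner ℝ (conj x) (conj fun i => |x i|) +
          ‖conj fun i => |x i|‖ ^ 2 := norm_sub_sq_real _ _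
    rw [inner_sub_left, inner_sub_right, inner_sub_right, real_inner_self_eq_norm_sq] at hvar
    have : ‖conj x - conj fun i => |x i|‖ ^ 2 ≤ 0 := by linarith
    exact sub_eq_zero.1 (norm_eq_zero.1 (pow_eq_zero_iff two_ne_zero |>.1
      (le_antisymm this (sq_nonneg _))))
  change (conj x).PosSemidef
  rw [heq]
  exact hpsd _ fun i => abs_nonneg _

end Frobenius

section Multiplier

lemma norm_entry_le_frobenius_norm (A : Matrix (Fin n) (Fin n) ℂ) (i j : Fin n) :
    ‖A i j‖ ≤ ‖A‖ := by
  refine abs_le_of_sq_le_sq' ?_ (norm_nonneg _) |>.2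
  rw [frobenius_norm_sq]
  exact (Finset.single_le_sum (f := fun j => ‖A i j‖ ^ 2) (fun _ _ => sq_nonneg _)
    (Finset.mem_univ j)).trans (Finset.single_le_sum (f := fun i => ∑ j, ‖A i j‖ ^ 2)
      (fun _ _ => Finset.sum_nonneg fun _ _ => sq_nonneg _) (Finset.mem_univ i))

lemma frobenius_norm_le_of_norm_entry_le {A : Matrix (Fin n) (Fin n) ℂ} {c : ℝ} (hc : 0 ≤ c)
    (hA : ∀ i j, ‖A i j‖ ≤ c) : ‖A‖ ≤ n * c := by
  refine abs_le_of_sq_le_sq' ?_ (by positivity) |>.2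
  calc ‖A‖ ^ 2 ≤ ∑ _i : Fin n, ∑ _j : Fin n, c ^ 2 := by
        rw [frobenius_norm_sq]
        gcongr with i _ j _
        exact hA i j
    _ = (n * c) ^ 2 := by simp; ring

lemma frobenius_norm_vecMulVec_le (v w : Fin n → ℂ) :
    ‖vecMulVec v w‖ ≤ n * (‖v‖ * ‖w‖) := by
  refine frobenius_norm_le_of_norm_entry_le (by positivity) fun i j => ?_
  rw [vecMulVec_apply, norm_mul]
  gcongr <;> exact norm_le_pi_norm _ _

lemma norm_vecMulVec_self_star_sub_le (v w : Fin n → ℂ) :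
    ‖vecMulVec v (star v) - vecMulVec w (star w)‖ ≤ n * ((‖v‖ + ‖w‖) * ‖v - w‖) := by
  have h : vecMulVec v (star v) - vecMulVec w (star w) =
      vecMulVec (v - w) (star v) + vecMulVec w (star (v - w)) := by
    ext i j
    simp [vecMulVec_apply]
    ring
  rw [h]
  refine (norm_add_le _ _).trans ((add_le_add (frobenius_norm_vecMulVec_le _ _)
    (frobenius_norm_vecMulVec_le _ _)).trans_eq ?_)
  rw [norm_star, norm_star]
  ring

lemma norm_star_dotProduct_mulVec_le (A : Matrix (Fin n) (Fin n) ℂ) (x y : Fin n → ℂ) :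
    ‖star x ⬝ᵥ A *ᵥ y‖ ≤ n ^ 2 * ‖A‖ * ‖x‖ * ‖y‖ := by
  have h : star x ⬝ᵥ A *ᵥ y = ∑ i, ∑ j, star (x i) * (A i j * y j) := by
    simp [dotProduct, mulVec, Finset.mul_sum]
  calc ‖star x ⬝ᵥ A *ᵥ y‖ ≤ ∑ i, ∑ j, ‖star (x i) * (A i j * y j)‖ := by
        rw [h]
        exact (norm_sum_le _ _).trans (Finset.sum_le_sum fun i _ => norm_sum_le _ _)
    _ ≤ ∑ _i : Fin n, ∑ _j : Fin n, ‖x‖ * (‖A‖ * ‖y‖) := by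
        gcongr with i _ j _
        rw [norm_mul, norm_mul, norm_star]
        gcongr
        · exact norm_le_pi_norm x i
        · exact norm_entry_le_frobenius_norm A i j
        · exact norm_le_pi_norm y j
    _ = n ^ 2 * ‖A‖ * ‖x‖ * ‖y‖ := by simp; ring

lemma sq_norm_le_re_star_dotProduct (x : Fin n → ℂ) : ‖x‖ ^ 2 ≤ (star x ⬝ᵥ x).re := by
  have h : (star x ⬝ᵥ x).re = ∑ i, ‖x i‖ ^ 2 := by
    simp [dotProduct, Complex.sq_norm, Complex.normSq_apply]
  rw [h]
  refine (Real.le_sqrt (norm_nonneg x) (Finset.sum_nonneg fun _ _ => sq_nonneg _)).1 ?_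
  refine (pi_norm_le_iff_of_nonneg (Real.sqrt_nonneg _)).2 fun i => ?_
  exact Real.le_sqrt_of_sq_le (Finset.single_le_sum (f := fun i => ‖x i‖ ^ 2)
    (fun _ _ => sq_nonneg _) (Finset.mem_univ i))

/-- The regularized Rayleigh denominator is bounded below by `δ ‖x‖²`. -/
lemma mul_sq_norm_le_norm_regularized {S : Matrix (Fin n) (Fin n) ℂ} (hS : S.PosSemidef)
    {δ : ℝ} (hδ : 0 < δ) (x : Fin n → ℂ) :
    δ * ‖x‖ ^ 2 ≤ ‖star x ⬝ᵥ (δ • (1 : Matrix (Fin n) (Fin n) ℂ) + S) *ᵥ x‖ := by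
  refine le_trans ?_ (Complex.re_le_norm _)
  have h1 := (Complex.le_def.1 (hS.dotProduct_mulVec_nonneg x)).1
  have h2 := sq_norm_le_re_star_dotProduct x
  rw [add_mulVec, dotProduct_add, smul_mulVec, one_mulVec, dotProduct_smul, Complex.add_re,
    Complex.smul_re, smul_eq_mul]
  simp only [Complex.zero_re] at h1
  nlinarith

lemma norm_regularized_le {Δ : ℝ} {S : Matrix (Fin n) (Fin n) ℂ} (hS : S ∈ Kset n Δ)
    {δ : ℝ} (hδ : 0 < δ) (hδ1 : δ ≤ 1) :
    ‖δ • (1 : Matrix (Fin n) (Fin n) ℂ) + S‖ ≤ ‖(1 : Matrix (Fin n) (Fin n) ℂ)‖ + Δ := by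
  refine (norm_add_le _ _).trans (add_le_add ?_ (hS.1.frobenius_norm_le_trace.trans hS.2))
  rw [norm_smul, Real.norm_of_nonneg hδ.le]
  exact mul_le_of_le_one_left (norm_nonneg _) hδ1

variable {f : Fin n → C(↥(Ω₀ ∪ α • Ω₀), ℂ)} {ξ : EuclideanSpace ℝ (Fin d)} {Δ δ : ℝ}
  {S S' : Matrix (Fin n) (Fin n) ℂ}

lemma norm_Mreg_mul_norm_le (hf : fLow f ξ ≠ 0) (hS : S ∈ Kset n Δ) (hδ : 0 < δ) (hδ1 : δ ≤ 1) :
    ‖Mreg f δ S ξ‖ * ‖fLow f ξ‖ ≤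
      n ^ 2 * (‖(1 : Matrix (Fin n) (Fin n) ℂ)‖ + Δ) * ‖fHigh f ξ‖ / δ := by
  have ha : 0 < ‖fLow f ξ‖ := norm_pos_iff.2 hf
  have hD := mul_sq_norm_le_norm_regularized hS.1 hδ (fLow f ξ)
  have hN := (norm_star_dotProduct_mulVec_le (δ • (1 : Matrix (Fin n) (Fin n) ℂ) + S)
    (fLow f ξ) (fHigh f ξ))
  have hD0 := (by positivity : 0 < δ * ‖fLow f ξ‖ ^ 2)
  have hB := norm_regularized_le hS hδ hδ1
  rw [Mreg, norm_div]
  calc _ ≤ n ^ 2 * (‖(1 : Matrix (Fin n) (Fin n) ℂ)‖ + Δ) * ‖fLow f ξ‖ * ‖fHigh f ξ‖ /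
        (δ * ‖fLow f ξ‖ ^ 2) * ‖fLow f ξ‖ := by
        have hN' := hN.trans (by gcongr :
          _ ≤ n ^ 2 * (‖(1 : Matrix (Fin n) (Fin n) ℂ)‖ + Δ) * ‖fLow f ξ‖ * ‖fHigh f ξ‖)
        gcongr
        exact (norm_nonneg _).trans hN'
    _ = _ := by field_simp

lemma norm_Mreg_sub_mul_norm_le (hf : fLow f ξ ≠ 0) (hS : S ∈ Kset n Δ) (hS' : S' ∈ Kset n Δ)
    (hδ : 0 < δ) (hδ1 : δ ≤ 1) :
    ‖Mreg f δ S ξ - Mreg f δ S' ξ‖ * ‖fLow f ξ‖ ≤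
      (n ^ 2 + n ^ 4 * (‖(1 : Matrix (Fin n) (Fin n) ℂ)‖ + Δ)) * ‖fHigh f ξ‖ * ‖S - S'‖ /
        δ ^ 2 := by
  have hm := norm_Mreg_mul_norm_le (f := f) hf hS' hδ hδ1
  have ha : 0 < ‖fLow f ξ‖ := norm_pos_iff.2 hf
  have hD := mul_sq_norm_le_norm_regularized hS.1 hδ (fLow f ξ)
  have hD' := mul_sq_norm_le_norm_regularized hS'.1 hδ (fLow f ξ)
  have hD0 := (by positivity : 0 < δ * ‖fLow f ξ‖ ^ 2)
  have hN := norm_star_dotProduct_mulVec_le (S - S') (fLow f ξ) (fHigh f ξ)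
  have hE := norm_star_dotProduct_mulVec_le (S - S') (fLow f ξ) (fLow f ξ)
  have hne : star (fLow f ξ) ⬝ᵥ (δ • (1 : Matrix (Fin n) (Fin n) ℂ) + S) *ᵥ fLow f ξ ≠ 0 :=
    norm_pos_iff.1 (hD0.trans_le hD)
  have hne' : star (fLow f ξ) ⬝ᵥ (δ • (1 : Matrix (Fin n) (Fin n) ℂ) + S') *ᵥ fLow f ξ ≠ 0 :=
    norm_pos_iff.1 (hD0.trans_le hD')
  have hlin : ∀ y : Fin n → ℂ, star (fLow f ξ) ⬝ᵥ (S - S') *ᵥ y =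
      star (fLow f ξ) ⬝ᵥ (δ • (1 : Matrix (Fin n) (Fin n) ℂ) + S) *ᵥ y -
        star (fLow f ξ) ⬝ᵥ (δ • (1 : Matrix (Fin n) (Fin n) ℂ) + S') *ᵥ y := by
    intro y
    rw [← dotProduct_sub, ← sub_mulVec, add_sub_add_left_eq_sub]
  have key : Mreg f δ S ξ - Mreg f δ S' ξ =
      (star (fLow f ξ) ⬝ᵥ (S - S') *ᵥ fHigh f ξ -
        Mreg f δ S' ξ * (star (fLow f ξ) ⬝ᵥ (S - S') *ᵥ fLow f ξ)) /
      (star (fLow f ξ) ⬝ᵥ (δ • (1 : Matrix (Fin n) (Fin n) ℂ) + S) *ᵥ fLow f ξ) := by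
    rw [hlin, hlin, Mreg, Mreg]
    field_simp
    ring
  have hnum : ‖star (fLow f ξ) ⬝ᵥ (S - S') *ᵥ fHigh f ξ -
        Mreg f δ S' ξ * (star (fLow f ξ) ⬝ᵥ (S - S') *ᵥ fLow f ξ)‖ ≤
      (n ^ 2 + n ^ 4 * (‖(1 : Matrix (Fin n) (Fin n) ℂ)‖ + Δ)) * ‖fHigh f ξ‖ * ‖S - S'‖ / δ *
        ‖fLow f ξ‖ := by
    calc _ ≤ n ^ 2 * ‖S - S'‖ * ‖fLow f ξ‖ * ‖fHigh f ξ‖ +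
          ‖Mreg f δ S' ξ‖ * (n ^ 2 * ‖S - S'‖ * ‖fLow f ξ‖ * ‖fLow f ξ‖) := by
          refine (norm_sub_le _ _).trans (add_le_add hN ?_)
          rw [norm_mul]
          gcongr
      _ = n ^ 2 * ‖S - S'‖ * ‖fLow f ξ‖ * ‖fHigh f ξ‖ * 1 +
          (‖Mreg f δ S' ξ‖ * ‖fLow f ξ‖) * (n ^ 2 * ‖S - S'‖ * ‖fLow f ξ‖) := by ring
      _ ≤ n ^ 2 * ‖S - S'‖ * ‖fLow f ξ‖ * ‖fHigh f ξ‖ * (1 / δ) +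
          (n ^ 2 * (‖(1 : Matrix (Fin n) (Fin n) ℂ)‖ + Δ) * ‖fHigh f ξ‖ / δ) *
            (n ^ 2 * ‖S - S'‖ * ‖fLow f ξ‖) := by
          gcongr
          exact (one_le_div hδ).2 hδ1
      _ = _ := by ring
  rw [key, norm_div]
  calc _ ≤ (n ^ 2 + n ^ 4 * (‖(1 : Matrix (Fin n) (Fin n) ℂ)‖ + Δ)) * ‖fHigh f ξ‖ * ‖S - S'‖ /
        δ * ‖fLow f ξ‖ / (δ * ‖fLow f ξ‖ ^ 2) * ‖fLow f ξ‖ := by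
        gcongr
        exact (norm_nonneg _).trans hnum
    _ = _ := by field_simp

lemma norm_residual_le (hf : fLow f ξ ≠ 0) (hS : S ∈ Kset n Δ) (hδ : 0 < δ) (hδ1 : δ ≤ 1) :
    ‖fHigh f ξ - Mreg f δ S ξ • fLow f ξ‖ ≤
      (1 + n ^ 2 * (‖(1 : Matrix (Fin n) (Fin n) ℂ)‖ + Δ)) * ‖fHigh f ξ‖ / δ := by
  have hm := norm_Mreg_mul_norm_le (f := f) hf hS hδ hδ1
  have h1 : ‖fHigh f ξ‖ ≤ ‖fHigh f ξ‖ / δ := le_div_self (norm_nonneg _) hδ hδ1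
  calc _ ≤ ‖fHigh f ξ‖ + ‖Mreg f δ S ξ‖ * ‖fLow f ξ‖ := by
        rw [← norm_smul]
        exact norm_sub_le _ _
    _ ≤ ‖fHigh f ξ‖ / δ +
        n ^ 2 * (‖(1 : Matrix (Fin n) (Fin n) ℂ)‖ + Δ) * ‖fHigh f ξ‖ / δ := add_le_add h1 hm
    _ = _ := by ring

/-- Pointwise Lipschitz bound, of order `δ⁻³`, for the Gram integrand. -/
lemma norm_gram_integrand_sub_le (hf : fLow f ξ ≠ 0) (hS : S ∈ Kset n Δ) (hS' : S' ∈ Kset n Δ)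
    (hΔ : 0 ≤ Δ) (hδ : 0 < δ) (hδ1 : δ ≤ 1) {M : ℝ} (hM : ‖fHigh f ξ‖ ≤ M) :
    ‖vecMulVec (fHigh f ξ - Mreg f δ S ξ • fLow f ξ)
        (star (fHigh f ξ - Mreg f δ S ξ • fLow f ξ)) -
      vecMulVec (fHigh f ξ - Mreg f δ S' ξ • fLow f ξ)
        (star (fHigh f ξ - Mreg f δ S' ξ • fLow f ξ))‖ ≤
      2 * n * (1 + n ^ 2 * (‖(1 : Matrix (Fin n) (Fin n) ℂ)‖ + Δ)) *
        (n ^ 2 + n ^ 4 * (‖(1 : Matrix (Fin n) (Fin n) ℂ)‖ + Δ)) * M ^ 2 / δ ^ 3 * ‖S - S'‖ := by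
  have hM0 : 0 ≤ M := (norm_nonneg _).trans hM
  have h1 := norm_residual_le (f := f) hf hS hδ hδ1
  have h2 := norm_residual_le (f := f) hf hS' hδ hδ1
  have h3 : ‖(fHigh f ξ - Mreg f δ S ξ • fLow f ξ) - (fHigh f ξ - Mreg f δ S' ξ • fLow f ξ)‖ ≤
      (n ^ 2 + n ^ 4 * (‖(1 : Matrix (Fin n) (Fin n) ℂ)‖ + Δ)) * ‖fHigh f ξ‖ * ‖S - S'‖ /
        δ ^ 2 := by
    rw [sub_sub_sub_cancel_left, ← sub_smul, norm_smul, norm_sub_rev]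
    exact norm_Mreg_sub_mul_norm_le hf hS hS' hδ hδ1
  refine (norm_vecMulVec_self_star_sub_le _ _).trans ?_
  set B := ‖(1 : Matrix (Fin n) (Fin n) ℂ)‖ + Δ
  have hB : 0 ≤ B := by positivity
  calc _ ≤ n * (((1 + n ^ 2 * B) * M / δ + (1 + n ^ 2 * B) * M / δ) *
        ((n ^ 2 + n ^ 4 * B) * M * ‖S - S'‖ / δ ^ 2)) := by
        gcongr
        · exact h1.trans (by gcongr)
        · exact h2.trans (by gcongr)
        · exact h3.trans (by gcongr)
    _ = _ := by field_simp; ring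

end Multiplier

section Gram

lemma continuousOn_fLow (f : Fin n → C(↥(Ω₀ ∪ α • Ω₀), ℂ)) : ContinuousOn (fLow f) Ω₀ := by
  rw [continuousOn_iff_continuous_domRestrict]
  refine continuous_pi fun i => ?_
  have : (fun x : Ω₀ => Ω₀.domRestrict (fLow f) x i) =
      fun x : Ω₀ => f i ⟨x, Or.inl x.2⟩ := by
    ext x
    simp [fLow, Set.domRestrict]
  rw [this]
  fun_prop

lemma continuousOn_fHigh (f : Fin n → C(↥(Ω₀ ∪ α • Ω₀), ℂ)) : ContinuousOn (fHigh f) Ω₀ := by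
  rw [continuousOn_iff_continuous_domRestrict]
  refine continuous_pi fun i => ?_
  have : (fun x : Ω₀ => Ω₀.domRestrict (fHigh f) x i) =
      fun x : Ω₀ => f i ⟨α • (x : EuclideanSpace ℝ (Fin d)),
        Or.inr (smul_mem_smul_set x.2)⟩ := by
    ext x
    simp [fHigh, Set.domRestrict]
  rw [this]
  fun_prop

variable {f : Fin n → C(↥(Ω₀ ∪ α • Ω₀), ℂ)} {Δ δ : ℝ} {S : Matrix (Fin n) (Fin n) ℂ}

lemma continuousOn_Mreg (hnz : ∀ ξ ∈ Ω₀, fLow f ξ ≠ 0) (hS : S.PosSemidef) (hδ : 0 < δ) :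
    ContinuousOn (Mreg f δ S) Ω₀ := by
  have hL := continuousOn_fLow f
  have hH := continuousOn_fHigh f
  rw [continuousOn_iff_continuous_domRestrict] at *
  have hform : ∀ {g h : Ω₀ → Fin n → ℂ}, Continuous g → Continuous h → Continuous fun x =>
      star (g x) ⬝ᵥ (δ • (1 : Matrix (Fin n) (Fin n) ℂ) + S) *ᵥ h x := fun hg hh =>
    hg.star.dotProduct (continuous_const.matrix_mulVec hh)
  refine (hform hL hH).div₀ (hform hL hL) fun x => ?_
  have hpos : 0 < δ * ‖fLow f x‖ ^ 2 := by
    have := norm_pos_iff.2 (hnz x x.2)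
    positivity
  exact norm_pos_iff.1 (hpos.trans_le (mul_sq_norm_le_norm_regularized hS hδ _))

lemma continuousOn_gram_integrand (hnz : ∀ ξ ∈ Ω₀, fLow f ξ ≠ 0) (hS : S.PosSemidef)
    (hδ : 0 < δ) :
    ContinuousOn (fun ξ => vecMulVec (fHigh f ξ - Mreg f δ S ξ • fLow f ξ)
      (star (fHigh f ξ - Mreg f δ S ξ • fLow f ξ))) Ω₀ := by
  have hv : ContinuousOn (fun ξ => fHigh f ξ - Mreg f δ S ξ • fLow f ξ) Ω₀ :=
    (continuousOn_fHigh f).sub ((continuousOn_Mreg hnz hS hδ).smul (continuousOn_fLow f))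
  rw [continuousOn_iff_continuous_domRestrict] at *
  exact Continuous.matrix_vecMulVec hv hv.star

attribute [local instance] frobeniusInnerProductSpace in
lemma inner_gramFun_nonneg (hΩ₀ : IsCompact Ω₀)
    (μ : Measure (EuclideanSpace ℝ (Fin d))) [IsFiniteMeasure μ]
    (hnz : ∀ ξ ∈ Ω₀, fLow f ξ ≠ 0) (hS : S.PosSemidef) (hδ : 0 < δ)
    {Q : Matrix (Fin n) (Fin n) ℂ} (hQ : Q.PosSemidef) :
    0 ≤ inner ℝ Q (gramFun μ f (Mreg f δ S)) := by
  rw [gramFun, real_inner_smul_right,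
    ← integral_inner ((continuousOn_gram_integrand hnz hS hδ).integrableOn_compact hΩ₀)]
  exact mul_nonneg (by norm_num)
    (integral_nonneg fun ξ => inner_vecMulVec_self_star_nonneg hQ _)

/-- On `K_Δ` the regularized Gram map is Lipschitz with constant of order `δ⁻³`. -/
lemma exists_norm_gramFun_sub_le (hΩ₀ : IsCompact Ω₀)
    (μ : Measure (EuclideanSpace ℝ (Fin d))) [IsFiniteMeasure μ]
    (hnz : ∀ ξ ∈ Ω₀, fLow f ξ ≠ 0) (hΔ : 0 ≤ Δ) :
    ∃ C > 0, ∀ δ : ℝ, 0 < δ → δ ≤ 1 → ∀ S ∈ Kset n Δ, ∀ S' ∈ Kset n Δ,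
      ‖gramFun μ f (Mreg f δ S) - gramFun μ f (Mreg f δ S')‖ ≤ C / δ ^ 3 * ‖S - S'‖ := by
  obtain ⟨M, hM⟩ := hΩ₀.exists_bound_of_continuousOn (continuousOn_fHigh f)
  set K := 2 * n * (1 + n ^ 2 * (‖(1 : Matrix (Fin n) (Fin n) ℂ)‖ + Δ)) *
        (n ^ 2 + n ^ 4 * (‖(1 : Matrix (Fin n) (Fin n) ℂ)‖ + Δ)) * M ^ 2 with hK
  have hK0 : 0 ≤ K := by positivity
  refine ⟨K * μ.real Ω₀ + 1, by positivity, fun δ hδ hδ1 S hS S' hS' => ?_⟩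
  have hint := norm_setIntegral_le_of_norm_le_const (μ := μ) hΩ₀.measure_lt_top fun ξ hξ =>
    norm_gram_integrand_sub_le (hnz ξ hξ) hS hS' hΔ hδ hδ1 (hM ξ hξ)
  rw [integral_sub ((continuousOn_gram_integrand hnz hS.1 hδ).integrableOn_compact hΩ₀)
    ((continuousOn_gram_integrand hnz hS'.1 hδ).integrableOn_compact hΩ₀), ← hK] at hint
  rw [gramFun, gramFun, ← smul_sub, norm_smul, Real.norm_of_nonneg (by norm_num)]
  calc _ ≤ 1 * (K / δ ^ 3 * ‖S - S'‖ * μ.real Ω₀) := by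
        gcongr
        norm_num
    _ = K * μ.real Ω₀ / δ ^ 3 * ‖S - S'‖ := by ring
    _ ≤ _ := by
        gcongr
        linarith

end Gram

lemma isClosed_Kset (Δ : ℝ) : IsClosed (Kset n Δ) := by
  have h : Kset n Δ = {A | Aᴴ = A} ∩ (⋂ x : Fin n → ℂ, {A | 0 ≤ star x ⬝ᵥ A *ᵥ x}) ∩
      {A | A.trace.re ≤ Δ} := by
    ext A
    simp [Kset, posSemidef_iff_dotProduct_mulVec, Matrix.IsHermitian]
  rw [h]
  refine ((isClosed_eq (by fun_prop) continuous_id).inter (isClosed_iInter fun x => ?_)).inter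
    (isClosed_le (Complex.continuous_re.comp (by fun_prop)) continuous_const)
  exact isClosed_le continuous_const (by fun_prop)

attribute [local instance] frobeniusInnerProductSpace in
/-- The update map sends `K_Δ` into itself. -/
lemma mapsTo_proj_Kset (hΩ₀ : IsCompact Ω₀)
    (μ : Measure (EuclideanSpace ℝ (Fin d))) [IsFiniteMeasure μ]
    {f : Fin n → C(↥(Ω₀ ∪ α • Ω₀), ℂ)} (hnz : ∀ ξ ∈ Ω₀, fLow f ξ ≠ 0)
    {W : Set (Matrix (Fin n) (Fin n) ℂ)} (hWconv : Convex ℝ W) {D : Set (Fin n → ℝ)}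
    (hD : ∀ x ∈ D, ∀ s : Fin n → ℝ, (∀ i, s i = 1 ∨ s i = -1) → (fun i => s i * x i) ∈ D)
    (hWD : W = {X | ∃ U ∈ Matrix.unitaryGroup (Fin n) ℂ, ∃ dv ∈ D,
      X = U * Matrix.diagonal (fun i => (dv i : ℂ)) * star U})
    {proj : Matrix (Fin n) (Fin n) ℂ → Matrix (Fin n) (Fin n) ℂ}
    (hproj : ∀ X, proj X ∈ W ∧ ∀ Y ∈ W, ‖X - proj X‖ ≤ ‖X - Y‖)
    {Δ : ℝ} (hΔW : ∀ X ∈ W, (X.trace).re ≤ Δ) {δ a b : ℝ} (hδ : 0 < δ) (ha : 0 ≤ a)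
    (hb : 0 ≤ b) :
    MapsTo (fun S => proj (a • S + b • gramFun μ f (Mreg f δ S))) (Kset n Δ) (Kset n Δ) := by
  intro S hS
  refine ⟨posSemidef_of_isNearest hWconv hD hWD (hproj _).1 (hproj _).2 fun Q hQ => ?_,
    hΔW _ (hproj _).1⟩
  rw [inner_add_right, real_inner_smul_right, real_inner_smul_right]
  exact add_nonneg (mul_nonneg ha (hQ.frobenius_inner_nonneg hS.1))
    (mul_nonneg hb (inner_gramFun_nonneg hΩ₀ μ hnz hS.1 hδ hQ))

/-- Convergence of the regularized fixed-point iteration. -/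
theorem stmt11 (hd : 1 ≤ d) (hn : 1 ≤ n) (hα : 1 < α) (hΩ₀ : IsCompact Ω₀)
    [CompactSpace ↥(Ω₀ ∪ α • Ω₀)]
    (μ : Measure (EuclideanSpace ℝ (Fin d))) [IsFiniteMeasure μ]
    (f : Fin n → C(↥(Ω₀ ∪ α • Ω₀), ℂ))
    (hnz : ∀ ξ ∈ Ω₀, fLow f ξ ≠ 0)
    (W : Set (Matrix (Fin n) (Fin n) ℂ))
    (hWne : W.Nonempty) (hWc : IsCompact W) (hWconv : Convex ℝ W)
    (hWH : ∀ X ∈ W, X.IsHermitian)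
    (hWU : ∀ U ∈ Matrix.unitaryGroup (Fin n) ℂ, ∀ X ∈ W, star U * X * U ∈ W)
    (hWspec : ∃ DW : Set (Fin n → ℝ),
      Convex ℝ DW ∧
      (∀ σ : Equiv.Perm (Fin n), ∀ x ∈ DW, x ∘ σ ∈ DW) ∧
      (∀ x ∈ DW, ∀ s : Fin n → ℝ, (∀ i, s i = 1 ∨ s i = -1) → (fun i => s i * x i) ∈ DW) ∧
      W = {X | ∃ U ∈ Matrix.unitaryGroup (Fin n) ℂ, ∃ dv ∈ DW,
        X = U * Matrix.diagonal (fun i => (dv i : ℂ)) * star U})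
    (proj : Matrix (Fin n) (Fin n) ℂ → Matrix (Fin n) (Fin n) ℂ)
    (hproj : ∀ X : Matrix (Fin n) (Fin n) ℂ,
      proj X ∈ W ∧ ∀ Y ∈ W, ‖X - proj X‖ ≤ ‖X - Y‖)
    (Δ : ℝ) (hΔn : (n : ℝ) < Δ) (hΔW : ∀ X ∈ W, (X.trace).re ≤ Δ) :
    ∃ CFPI > (0 : ℝ), ∀ δ τS τG : ℝ, 0 < δ → δ ≤ 1 → 0 < τS → 0 < τG →
      τS + CFPI * τG / δ ^ 3 < 1 →
      ∀ Sig0 ∈ Kset n Δ,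
        Set.MapsTo (fun Sig => proj (τS • Sig + τG • gramFun μ f (Mreg f δ Sig)))
          (Kset n Δ) (Kset n Δ) ∧
        (∃ L : ℝ≥0, L < 1 ∧
          LipschitzOnWith L (fun Sig => proj (τS • Sig + τG • gramFun μ f (Mreg f δ Sig)))
            (Kset n Δ)) ∧
        ∃ Sstar ∈ Kset n Δ,
          proj (τS • Sstar + τG • gramFun μ f (Mreg f δ Sstar)) = Sstar ∧
          (∀ Sig' ∈ Kset n Δ,
            proj (τS • Sig' + τG • gramFun μ f (Mreg f δ Sig')) = Sig' → Sig' = Sstar) ∧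
          Tendsto
            (fun k => (fun Sig => proj (τS • Sig + τG • gramFun μ f (Mreg f δ Sig)))^[k] Sig0)
            atTop (𝓝 Sstar) := by
  obtain ⟨D, -, -, hD, hWD⟩ := hWspec
  obtain ⟨C, hC, hgram⟩ := exists_norm_gramFun_sub_le (f := f) hΩ₀ μ hnz
    ((Nat.cast_nonneg n).trans hΔn.le)
  refine ⟨C, hC, fun δ τS τG hδ hδ1 hτS hτG hlt Sig0 hSig0 => ?_⟩
  set F : Matrix (Fin n) (Fin n) ℂ → Matrix (Fin n) (Fin n) ℂ :=
    fun Sig => proj (τS • Sig + τG • gramFun μ f (Mreg f δ Sig)) with hF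
  have hmaps : MapsTo F (Kset n Δ) (Kset n Δ) :=
    mapsTo_proj_Kset hΩ₀ μ hnz hWconv hD hWD hproj hΔW hδ hτS.le hτG.le
  have hL0 : 0 ≤ τS + C * τG / δ ^ 3 := by positivity
  set L : ℝ≥0 := ⟨τS + C * τG / δ ^ 3, hL0⟩ with hLdef
  have hL : L < 1 := hlt
  have hlip : LipschitzOnWith L F (Kset n Δ) := by
    refine LipschitzOnWith.of_dist_le_mul fun S hS S' hS' => ?_
    rw [dist_eq_norm, dist_eq_norm]
    refine (norm_proj_sub_proj_le hWconv hproj _ _).trans ?_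
    rw [add_sub_add_comm, ← smul_sub, ← smul_sub]
    calc _ ≤ τS * ‖S - S'‖ + τG * (C / δ ^ 3 * ‖S - S'‖) := by
          refine (norm_add_le _ _).trans ?_
          rw [norm_smul, norm_smul, Real.norm_of_nonneg hτS.le, Real.norm_of_nonneg hτG.le]
          gcongr
          exact hgram δ hδ hδ1 S hS S' hS'
      _ = (τS + C * τG / δ ^ 3) * ‖S - S'‖ := by ring
  have hcontr : ContractingWith L (hmaps.restrict F _ _) := ⟨hL, hlip.mapsToRestrict hmaps⟩
  have : CompleteSpace (Matrix (Fin n) (Fin n) ℂ) := FiniteDimensional.complete ℝ _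
  obtain ⟨Sstar, hSstar, hfix, htend, -⟩ := ContractingWith.exists_fixedPoint'
    (isClosed_Kset Δ).isComplete hmaps hcontr hSig0 (edist_ne_top _ _)
  refine ⟨hmaps, ⟨L, hL, hlip⟩, Sstar, hSstar, hfix, fun S hS hSfix => ?_, htend⟩
  exact congrArg Subtype.val (hcontr.fixedPoint_unique'
    (x := (⟨S, hS⟩ : Kset n Δ)) (y := ⟨Sstar, hSstar⟩) (Subtype.ext hSfix) (Subtype.ext hfix))
end
end

section
/- Let m : ℝ^d → ℂ be measurable and ℤ^d-periodic with m(0) = 1. Assume there are a Lebesgue-null set Z ⊂ ℝ^d and B > 0 such that |m(ξ)| ≤ B for all ξ ∉ Z, and there are δ > 0, γ ∈ (0, 1], L > 0 such that |m(ξ₁) − m(ξ₂)| ≤ L·|ξ₁ − ξ₂|^γ for all ξ₁, ξ₂ in the open Euclidean ball of radius δ about the origin. Then there is a Lebesgue-null set Z* ⊂ ℝ^d such that for every ξ ∉ Z* the limit lim_{N→∞} ∏_{j=1}^N m(2^{−j}·ξ) exists and is finite, and for every compact K ⊂ ℝ^d the partial products converge uniformly on K \ Z*. -/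
open MeasureTheory Set Filter Topology

noncomputable section

/-- If `‖f n x - 1‖ ≤ v n` on `s` with `v` summable, the partial products of `f` converge uniformly
on `s`; the limit is written as a telescoping series, so that it does not depend on `s`. -/
theorem tendstoUniformlyOn_prod_range_of_summable {α : Type*} {f : ℕ → α → ℂ} {s : Set α}
    {v : ℕ → ℝ} (hv : Summable v) (h : ∀ n, ∀ x ∈ s, ‖f n x - 1‖ ≤ v n) (hv0 : ∀ n, 0 ≤ v n) :
    TendstoUniformlyOn (fun N x => ∏ j ∈ Finset.range N, f j x)
      (fun x => 1 + ∑' n, (∏ j ∈ Finset.range (n + 1), f j x - ∏ j ∈ Finset.range n, f j x))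
      atTop s := by
  have hP : ∀ n, ∀ x ∈ s, ‖∏ j ∈ Finset.range n, f j x‖ ≤ Real.exp (∑' j, v j) := by
    intro n x hx
    rw [norm_prod]
    calc ∏ j ∈ Finset.range n, ‖f j x‖ ≤ ∏ j ∈ Finset.range n, Real.exp (v j) := by
          refine Finset.prod_le_prod (fun _ _ => norm_nonneg _) fun j _ => ?_
          have h1 : ‖f j x‖ ≤ ‖f j x - 1‖ + ‖(1 : ℂ)‖ := by
            simpa using norm_add_le (f j x - 1) 1
          rw [norm_one] at h1
          linarith [h j x hx, Real.add_one_le_exp (v j)]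
      _ = Real.exp (∑ j ∈ Finset.range n, v j) := (Real.exp_sum _ _).symm
      _ ≤ Real.exp (∑' j, v j) := Real.exp_le_exp.2 (hv.sum_le_tsum _ fun j _ => hv0 j)
  have hu := tendstoUniformlyOn_tsum_nat (hv.mul_left (Real.exp (∑' j, v j)))
    (f := fun n x => ∏ j ∈ Finset.range (n + 1), f j x - ∏ j ∈ Finset.range n, f j x) (s := s)
    (fun n x hx => by
      rw [Finset.prod_range_succ, ← mul_sub_one, norm_mul]
      exact mul_le_mul (hP n x hx) (h n x hx) (norm_nonneg _) (Real.exp_pos _).le)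
  rw [Metric.tendstoUniformlyOn_iff] at hu ⊢
  intro ε hε
  filter_upwards [hu ε hε] with N hN x hx
  have hx' := hN x hx
  rw [Finset.sum_range_sub (fun n => ∏ j ∈ Finset.range n, f j x)] at hx'
  rw [dist_eq_norm] at hx' ⊢
  convert hx' using 2
  simp only [Finset.prod_range_zero]
  ring

/-- A function Hölder continuous at the origin and bounded off `Z` satisfies a global
Hölder-type bound at the origin off `Z`. -/
theorem norm_sub_one_le_of_holder_of_bounded {E : Type*} [NormedAddCommGroup E] {m : E → ℂ}
    (hm0 : m 0 = 1) {Z : Set E} {B δ γ L : ℝ} (hB : 0 < B) (hbd : ∀ ξ ∉ Z, ‖m ξ‖ ≤ B)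
    (hδ : 0 < δ) (hγ : 0 < γ) (hL : 0 < L)
    (hHolder : ∀ ξ ∈ Metric.ball (0 : E) δ, ‖m ξ - m 0‖ ≤ L * ‖ξ‖ ^ γ) {ξ : E} (hξ : ξ ∉ Z) :
    ‖m ξ - 1‖ ≤ (L + (B + 1) / δ ^ γ) * ‖ξ‖ ^ γ := by
  have hδγ : 0 < δ ^ γ := Real.rpow_pos_of_pos hδ γ
  have hξγ : 0 ≤ ‖ξ‖ ^ γ := Real.rpow_nonneg (norm_nonneg ξ) γ
  rw [add_mul]
  by_cases hlt : ‖ξ‖ < δ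
  · have h := hHolder ξ (by simpa using hlt)
    rw [hm0] at h
    have : 0 ≤ (B + 1) / δ ^ γ * ‖ξ‖ ^ γ := by positivity
    linarith
  · have h1 : ‖m ξ - 1‖ ≤ B + 1 := by
      have := norm_sub_le (m ξ) 1
      rw [norm_one] at this
      linarith [hbd ξ hξ]
    have h2 : B + 1 ≤ (B + 1) / δ ^ γ * ‖ξ‖ ^ γ := by
      rw [div_mul_eq_mul_div, le_div_iff₀ hδγ]
      gcongr
      exact not_lt.1 hlt
    have : 0 ≤ L * ‖ξ‖ ^ γ := by positivity
    linarith

/-- For a measurable, `ℤ^d`-periodic function `m` with `m(0) = 1`, bounded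
off a null set, and Hölder continuous near the origin, the infinite products
`∏_{j≥1} m(2^{-j} ξ)` converge off a null set `Z*`, uniformly on `K \ Z*` for every compact
`K`. -/
theorem stmt15 {d : ℕ} (hd : 1 ≤ d)
    (m : EuclideanSpace ℝ (Fin d) → ℂ) (hmeas : Measurable m)
    (hper : ∀ (ξ : EuclideanSpace ℝ (Fin d)) (z : Fin d → ℤ),
      m (ξ + ((WithLp.equiv 2 (Fin d → ℝ)).symm fun k => (z k : ℝ))) = m ξ)
    (hm0 : m 0 = 1)
    (Z : Set (EuclideanSpace ℝ (Fin d))) (hZ : volume Z = 0)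
    (B : ℝ) (hB : 0 < B) (hbd : ∀ ξ ∉ Z, ‖m ξ‖ ≤ B)
    (δ γ L : ℝ) (hδ : 0 < δ) (hγ : γ ∈ Set.Ioc (0 : ℝ) 1) (hL : 0 < L)
    (hHolder : ∀ ξ₁ ∈ Metric.ball (0 : EuclideanSpace ℝ (Fin d)) δ,
      ∀ ξ₂ ∈ Metric.ball (0 : EuclideanSpace ℝ (Fin d)) δ,
        ‖m ξ₁ - m ξ₂‖ ≤ L * ‖ξ₁ - ξ₂‖ ^ γ) :
    ∃ (Zstar : Set (EuclideanSpace ℝ (Fin d))) (φ : EuclideanSpace ℝ (Fin d) → ℂ),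
      volume Zstar = 0 ∧
      (∀ ξ ∉ Zstar,
        Tendsto (fun N : ℕ => ∏ j ∈ Finset.range N, m ((2 : ℝ) ^ (-(j : ℤ) - 1) • ξ))
          atTop (𝓝 (φ ξ))) ∧
      (∀ K : Set (EuclideanSpace ℝ (Fin d)), IsCompact K →
        TendstoUniformlyOn
          (fun (N : ℕ) (ξ : EuclideanSpace ℝ (Fin d)) =>
            ∏ j ∈ Finset.range N, m ((2 : ℝ) ^ (-(j : ℤ) - 1) • ξ))
          φ atTop (K \ Zstar)) := by
  set c : ℕ → ℝ := fun j => (2 : ℝ) ^ (-(j : ℤ) - 1) with hc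
  have hc0 : ∀ j, 0 < c j := fun j => by positivity
  have hcpow : ∀ j, c j = (1 / 2) ^ j * (1 / 2) := fun j => by
    simp only [hc]
    rw [zpow_sub₀ two_ne_zero, zpow_neg, zpow_natCast, zpow_one, one_div_pow]
    ring
  set Zstar : Set (EuclideanSpace ℝ (Fin d)) := ⋃ j : ℕ, (fun ξ => c j • ξ) ⁻¹' Z
  set C : ℝ := L + (B + 1) / δ ^ γ
  have hC0 : 0 ≤ C := by positivity
  have key : ∀ K : Set (EuclideanSpace ℝ (Fin d)), IsCompact K →
      TendstoUniformlyOn (fun (N : ℕ) ξ => ∏ j ∈ Finset.range N, m (c j • ξ))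
        (fun ξ => 1 + ∑' n, (∏ j ∈ Finset.range (n + 1), m (c j • ξ)
          - ∏ j ∈ Finset.range n, m (c j • ξ))) atTop (K \ Zstar) := by
    intro K hK
    obtain ⟨R, hR0, hR⟩ := hK.isBounded.exists_pos_norm_le
    have hsum : Summable fun n => C * (c n * R) ^ γ := by
      have hgeom : Summable fun n : ℕ => (((1 / 2 : ℝ) ^ γ) ^ n) :=
        summable_geometric_of_lt_one (by positivity)
          (Real.rpow_lt_one (by norm_num) (by norm_num) hγ.1)
      have heq : ∀ n, (c n * R) ^ γ = ((1 / 2 : ℝ) ^ γ) ^ n * (1 / 2 * R) ^ γ := fun n => by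
        rw [hcpow, mul_assoc, Real.mul_rpow (by positivity) (by positivity),
          Real.rpow_pow_comm (by norm_num)]
      simp only [heq]
      exact (hgeom.mul_right _).mul_left C
    refine tendstoUniformlyOn_prod_range_of_summable (f := fun j ξ => m (c j • ξ)) hsum ?_
      fun n => mul_nonneg hC0 (Real.rpow_nonneg (mul_pos (hc0 n) hR0).le _)
    rintro n ξ ⟨hξK, hξZ⟩
    have hnZ : c n • ξ ∉ Z := fun hmem => hξZ (mem_iUnion.2 ⟨n, hmem⟩)
    refine (norm_sub_one_le_of_holder_of_bounded hm0 hB hbd hδ hγ.1 hL (fun η hη => ?_)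
      hnZ).trans ?_
    · simpa using hHolder η hη 0 (Metric.mem_ball_self hδ)
    · refine mul_le_mul_of_nonneg_left ?_ hC0
      refine Real.rpow_le_rpow (norm_nonneg _) ?_ hγ.1.le
      rw [norm_smul, Real.norm_of_nonneg (hc0 n).le]
      exact mul_le_mul_of_nonneg_left (hR ξ hξK) (hc0 n).le
  refine ⟨Zstar, _, ?_, fun ξ hξ => ?_, key⟩
  · refine measure_iUnion_null fun j => ?_
    rw [Measure.addHaar_preimage_smul volume (hc0 j).ne', hZ, mul_zero]
  · exact (key {ξ} isCompact_singleton).tendsto_at ⟨mem_singleton ξ, hξ⟩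
end
end

section
/- Let m₀ : ℝ^d → ℂ be measurable and ℤ^d-periodic with m₀(0) = 1, γ-Hölder continuous on an open ball about the origin for some γ ∈ (0, 1], and satisfying |m₀(ξ)| ≤ C_p for Lebesgue-almost every ξ ∈ ℝ^d, where C_p > 0. Let N ∈ ℕ and set m := w_N·m₀ with w_N(ξ) := ∏_{k=1}^d ((1 + e^{2πi·ξ_k})/2)^N. Then the infinite product ∏_{j=1}^∞ m(2^{−j}·ξ) converges for almost every ξ ∈ ℝ^d, and there exists a constant C_m > 0 such that for almost every ξ ∈ ℝ^d, |∏_{j=1}^∞ m(2^{−j}·ξ)| ≤ C_m·(1 + |ξ|)^{−N + 2^{C_p}}. -/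
open MeasureTheory Set Filter Topology

noncomputable section

/-- The weight `w_N(ξ) = ∏_k ((1 + e^{2πiξ_k})/2)^N`. -/
def wWeight (d N : ℕ) (ξ : EuclideanSpace ℝ (Fin d)) : ℂ :=
  ∏ k, ((1 + Complex.exp (2 * Real.pi * Complex.I * (ξ k : ℂ))) / 2) ^ N

/-- The scalar factor of `wWeight` at the dyadic point `2^{-j-1} t`. -/
def dyadicFactor (t : ℝ) (j : ℕ) : ℂ :=
  (1 + Complex.exp (2 * Real.pi * Complex.I * (((2 : ℝ) ^ (-(j : ℤ) - 1) * t : ℝ) : ℂ))) / 2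

lemma two_zpow_neg_sub_one (j : ℕ) : (2 : ℝ) ^ (-(j : ℤ) - 1) = (1 / 2) ^ (j + 1) := by
  rw [show (-(j : ℤ) - 1) = -((j + 1 : ℕ) : ℤ) by push_cast; ring, zpow_neg, zpow_natCast]
  simp

lemma wWeight_dyadic {d : ℕ} (N j : ℕ) (ξ : EuclideanSpace ℝ (Fin d)) :
    wWeight d N ((2 : ℝ) ^ (-(j : ℤ) - 1) • ξ) = ∏ k, dyadicFactor (ξ k) j ^ N := by
  simp only [wWeight, dyadicFactor, PiLp.smul_apply, smul_eq_mul]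

lemma norm_exp_two_pi_I_mul_sub_one (x : ℝ) :
    ‖Complex.exp (2 * Real.pi * Complex.I * (x : ℂ)) - 1‖ = 2 * |Real.sin (Real.pi * x)| := by
  have := Complex.norm_exp_I_mul_ofReal_sub_one (2 * Real.pi * x)
  rw [show 2 * Real.pi * x / 2 = Real.pi * x by ring, norm_mul, Real.norm_eq_abs,
    Real.norm_eq_abs, abs_two] at this
  rw [← this]
  congr 3
  push_cast
  ring

lemma exists_tendsto_prod_dyadicFactor (t : ℝ) :
    ∃ p, Tendsto (fun M : ℕ => ∏ j ∈ Finset.range M, dyadicFactor t j) atTop (𝓝 p) := by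
  have hs : Summable fun j => dyadicFactor t j - 1 := by
    have hg : Summable fun j : ℕ => (Real.pi * |t|) * (1 / 2 : ℝ) ^ j :=
      summable_geometric_two.mul_left _
    refine Summable.of_norm_bounded hg fun j => ?_
    set x : ℝ := (2 : ℝ) ^ (-(j : ℤ) - 1) * t with hx
    have h1 : dyadicFactor t j - 1
        = (Complex.exp (2 * Real.pi * Complex.I * (x : ℂ)) - 1) / 2 := by
      rw [dyadicFactor, ← hx]
      ring
    have h2 : |Real.sin (Real.pi * x)| ≤ Real.pi * |x| := by
      refine Real.abs_sin_le_abs.trans_eq ?_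
      rw [abs_mul, abs_of_pos Real.pi_pos]
    have h3 : |x| ≤ |t| * (1 / 2 : ℝ) ^ j := by
      rw [hx, two_zpow_neg_sub_one, abs_mul, abs_of_pos (by positivity), mul_comm]
      gcongr ?_ * ?_
      exact pow_le_pow_of_le_one (by norm_num) (by norm_num) (Nat.le_succ j)
    rw [h1, norm_div, norm_exp_two_pi_I_mul_sub_one]
    have h4 := mul_le_mul_of_nonneg_left h3 Real.pi_pos.le
    norm_num
    norm_num at h4
    linarith
  have hm := multipliable_one_add_of_summable hs.norm
  simp only [add_sub_cancel] at hm
  exact ⟨_, hm.hasProd.tendsto_prod_nat⟩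

lemma norm_dyadicFactor_le_one (t : ℝ) (j : ℕ) : ‖dyadicFactor t j‖ ≤ 1 := by
  have h : ‖Complex.exp (2 * Real.pi * Complex.I *
      (((2 : ℝ) ^ (-(j : ℤ) - 1) * t : ℝ) : ℂ))‖ = 1 := by
    rw [← Complex.norm_exp_ofReal_mul_I (2 * Real.pi * ((2 : ℝ) ^ (-(j : ℤ) - 1) * t))]
    congr 2
    push_cast
    ring
  rw [dyadicFactor, norm_div, Complex.norm_ofNat]
  have := norm_add_le (1 : ℂ) (Complex.exp (2 * Real.pi * Complex.I *
      (((2 : ℝ) ^ (-(j : ℤ) - 1) * t : ℝ) : ℂ)))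
  rw [h, norm_one] at this
  linarith

lemma prod_dyadicFactor_mul (t : ℝ) (M : ℕ) :
    (∏ j ∈ Finset.range M, dyadicFactor t j) *
      (2 ^ M * (Complex.exp (2 * Real.pi * Complex.I * (((1 / 2) ^ M * t : ℝ) : ℂ)) - 1))
      = Complex.exp (2 * Real.pi * Complex.I * (t : ℂ)) - 1 := by
  induction M with
  | zero => simp
  | succ n ih =>
    rw [← ih, Finset.prod_range_succ, dyadicFactor, two_zpow_neg_sub_one]
    have : Complex.exp (2 * Real.pi * Complex.I * (((1 / 2) ^ n * t : ℝ) : ℂ))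
        = Complex.exp (2 * Real.pi * Complex.I * (((1 / 2) ^ (n + 1) * t : ℝ) : ℂ)) ^ 2 := by
      rw [← Complex.exp_nat_mul]
      congr 1
      push_cast
      ring
    rw [this]
    ring

lemma eventually_norm_prod_dyadicFactor_mul_le (t : ℝ) :
    ∀ᶠ M : ℕ in atTop, ‖∏ j ∈ Finset.range M, dyadicFactor t j‖ * (1 + |t|) ≤ 2 := by
  have hlim : Tendsto (fun M : ℕ => (1 / 2 : ℝ) ^ M * |t|) atTop (𝓝 0) := by
    simpa using (tendsto_pow_atTop_nhds_zero_of_lt_one (r := (1 / 2 : ℝ)) (by norm_num)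
      (by norm_num)).mul_const |t|
  filter_upwards [hlim.eventually (gt_mem_nhds (show (0 : ℝ) < 1 / 2 by norm_num))] with M hM
  have hone : ‖∏ j ∈ Finset.range M, dyadicFactor t j‖ ≤ 1 := by
    rw [norm_prod]
    exact Finset.prod_le_one (fun _ _ => norm_nonneg _) fun j _ => norm_dyadicFactor_le_one t j
  have key := congrArg norm (prod_dyadicFactor_mul t M)
  rw [norm_mul, norm_mul, norm_exp_two_pi_I_mul_sub_one, norm_exp_two_pi_I_mul_sub_one, norm_pow,
    Complex.norm_ofNat] at key
  have habs : |Real.pi * ((1 / 2) ^ M * t)| = Real.pi * ((1 / 2) ^ M * |t|) := by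
    rw [abs_mul, abs_mul, abs_of_pos Real.pi_pos, abs_of_pos (by positivity : (0 : ℝ) < (1/2)^M)]
  have hsin := Real.mul_abs_le_abs_sin (x := Real.pi * ((1 / 2) ^ M * t)) (by
    rw [habs]
    nlinarith [Real.pi_pos])
  have hle : 2 * |t| ≤ 2 ^ M * |Real.sin (Real.pi * ((1 / 2) ^ M * t))| := by
    calc 2 * |t| = 2 ^ M * (2 / Real.pi * |Real.pi * ((1 / 2) ^ M * t)|) := by
          rw [habs]
          have := Real.pi_ne_zero
          field_simp
          rw [mul_assoc, ← mul_pow]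
          norm_num
      _ ≤ _ := by gcongr
  have hone' := Real.abs_sin_le_one (Real.pi * t)
  have := mul_le_mul_of_nonneg_left hle
    (norm_nonneg (∏ j ∈ Finset.range M, dyadicFactor t j))
  nlinarith

lemma Finset.one_add_sum_le_prod_one_add {ι : Type*} (s : Finset ι) {f : ι → ℝ}
    (hf : ∀ i ∈ s, 0 ≤ f i) : 1 + ∑ i ∈ s, f i ≤ ∏ i ∈ s, (1 + f i) := by
  induction s using Finset.cons_induction with
  | empty => simp
  | cons a s ha ih =>
    have ha0 := hf a (Finset.mem_cons_self a s)
    have hs0 : ∀ i ∈ s, 0 ≤ f i := fun i hi => hf i (Finset.mem_cons_of_mem hi)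
    rw [Finset.sum_cons, Finset.prod_cons]
    nlinarith [ih hs0, mul_nonneg ha0 (Finset.sum_nonneg hs0),
      mul_le_mul_of_nonneg_left (ih hs0) ha0]

lemma EuclideanSpace.one_add_norm_le_prod {d : ℕ} (ξ : EuclideanSpace ℝ (Fin d)) :
    1 + ‖ξ‖ ≤ ∏ k, (1 + |ξ k|) := by
  have h1 : ‖ξ‖ ≤ ∑ k, |ξ k| := by
    rw [EuclideanSpace.norm_eq]
    refine Real.sqrt_le_iff.mpr ⟨Finset.sum_nonneg fun _ _ => abs_nonneg _, ?_⟩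
    exact Finset.sum_sq_le_sq_sum_of_nonneg fun _ _ => abs_nonneg _
  have h2 : 1 + ∑ k, |ξ k| ≤ ∏ k, (1 + |ξ k|) :=
    Finset.one_add_sum_le_prod_one_add _ fun _ _ => abs_nonneg _
  linarith

lemma prod_wWeight_dyadic {d : ℕ} (N M : ℕ) (ξ : EuclideanSpace ℝ (Fin d)) :
    ∏ j ∈ Finset.range M, wWeight d N ((2 : ℝ) ^ (-(j : ℤ) - 1) • ξ)
      = ∏ k, (∏ j ∈ Finset.range M, dyadicFactor (ξ k) j) ^ N := by
  simp_rw [wWeight_dyadic, ← Finset.prod_pow]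
  exact Finset.prod_comm

lemma exists_tendsto_prod_wWeight {d : ℕ} (N : ℕ) (ξ : EuclideanSpace ℝ (Fin d)) :
    ∃ p, Tendsto (fun M : ℕ => ∏ j ∈ Finset.range M,
      wWeight d N ((2 : ℝ) ^ (-(j : ℤ) - 1) • ξ)) atTop (𝓝 p) := by
  choose p hp using fun k => exists_tendsto_prod_dyadicFactor (ξ k)
  simp_rw [prod_wWeight_dyadic]
  exact ⟨_, tendsto_finsetProd _ fun k _ => (hp k).pow N⟩

lemma eventually_norm_prod_wWeight_le {d : ℕ} (N : ℕ) (ξ : EuclideanSpace ℝ (Fin d)) :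
    ∀ᶠ M : ℕ in atTop, ‖∏ j ∈ Finset.range M, wWeight d N ((2 : ℝ) ^ (-(j : ℤ) - 1) • ξ)‖
      ≤ (2 ^ d) ^ N * (1 + ‖ξ‖) ^ (-(N : ℝ)) := by
  have h := eventually_all.mpr fun k => eventually_norm_prod_dyadicFactor_mul_le (ξ k)
  filter_upwards [h] with M hM
  have hpos : 0 < 1 + ‖ξ‖ := by positivity
  rw [Real.rpow_neg hpos.le, Real.rpow_natCast, ← div_eq_mul_inv, le_div_iff₀ (by positivity),
    prod_wWeight_dyadic, Finset.prod_pow, norm_pow, norm_prod, ← mul_pow]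
  refine pow_le_pow_left₀ (by positivity) ?_ N
  calc _ ≤ (∏ k, ‖∏ j ∈ Finset.range M, dyadicFactor (ξ k) j‖) * ∏ k, (1 + |ξ k|) := by
        gcongr
        exact EuclideanSpace.one_add_norm_le_prod ξ
    _ = ∏ k, ‖∏ j ∈ Finset.range M, dyadicFactor (ξ k) j‖ * (1 + |ξ k|) :=
        Finset.prod_mul_distrib.symm
    _ ≤ ∏ _k : Fin d, (2 : ℝ) :=
        Finset.prod_le_prod (fun _ _ => by positivity) fun k _ => hM k
    _ = 2 ^ d := by simp

lemma prod_one_add_geometric_le {L c : ℝ} (hL : 0 ≤ L) (hc : 0 ≤ c) (hc1 : c < 1) (M : ℕ) :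
    ∏ i ∈ Finset.range M, (1 + L * c ^ i) ≤ Real.exp (L * (1 - c)⁻¹) := by
  calc ∏ i ∈ Finset.range M, (1 + L * c ^ i) ≤ Real.exp (∑ i ∈ Finset.range M, L * c ^ i) :=
        Real.prod_one_add_le_exp_sum _ fun _ => by positivity
    _ = Real.exp (L * ∑ i ∈ Finset.range M, c ^ i) := by
        rw [Finset.mul_sum]
    _ ≤ _ := by
        gcongr
        rw [← tsum_geometric_of_lt_one hc hc1]
        exact (summable_geometric_of_lt_one hc hc1).sum_le_tsum _ fun _ _ => by positivity

lemma norm_two_zpow_smul {d : ℕ} (j : ℕ) (ξ : EuclideanSpace ℝ (Fin d)) :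
    ‖(2 : ℝ) ^ (-(j : ℤ) - 1) • ξ‖ = (1 / 2) ^ (j + 1) * ‖ξ‖ := by
  rw [two_zpow_neg_sub_one, norm_smul, Real.norm_of_nonneg (by positivity)]

section HolderAtZero

variable {d : ℕ} {f : EuclideanSpace ℝ (Fin d) → ℂ} {δ γ L : ℝ}

lemma exists_tendsto_prod_of_holder_at_zero (hδ : 0 < δ) (hγ : 0 < γ)
    (hf : ∀ ξ ∈ Metric.ball (0 : EuclideanSpace ℝ (Fin d)) δ, ‖f ξ - 1‖ ≤ L * ‖ξ‖ ^ γ)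
    (ξ : EuclideanSpace ℝ (Fin d)) :
    ∃ p, Tendsto (fun M : ℕ => ∏ j ∈ Finset.range M, f ((2 : ℝ) ^ (-(j : ℤ) - 1) • ξ))
      atTop (𝓝 p) := by
  have hlim : Tendsto (fun j : ℕ => ‖(2 : ℝ) ^ (-(j : ℤ) - 1) • ξ‖) atTop (𝓝 0) := by
    simp_rw [norm_two_zpow_smul]
    simpa using ((tendsto_pow_atTop_nhds_zero_of_lt_one (r := (1 / 2 : ℝ)) (by norm_num)
      (by norm_num)).comp (tendsto_add_atTop_nat 1)).mul_const ‖ξ‖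
  have hs : Summable fun j : ℕ => f ((2 : ℝ) ^ (-(j : ℤ) - 1) • ξ) - 1 := by
    have hg : Summable fun j : ℕ =>
        L * ((1 / 2) ^ γ * ‖ξ‖ ^ γ) * ((1 / 2 : ℝ) ^ γ) ^ j :=
      (summable_geometric_of_lt_one (by positivity)
        (Real.rpow_lt_one (by norm_num) (by norm_num) hγ)).mul_left _
    refine Summable.of_norm_bounded_eventually_nat hg ?_
    filter_upwards [hlim.eventually (gt_mem_nhds hδ)] with j hj
    refine (hf _ (by simpa using hj)).trans_eq ?_
    rw [norm_two_zpow_smul, Real.mul_rpow (by positivity) (norm_nonneg _),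
      ← Real.rpow_pow_comm (by norm_num), pow_succ]
    ring
  have hm := multipliable_one_add_of_summable hs.norm
  simp only [add_sub_cancel] at hm
  exact ⟨_, hm.hasProd.tendsto_prod_nat⟩

lemma exists_eventually_norm_prod_le_of_holder_at_zero (hδ : 0 < δ) (hγ : 0 < γ) (hL : 0 ≤ L)
    (hf : ∀ ξ ∈ Metric.ball (0 : EuclideanSpace ℝ (Fin d)) δ, ‖f ξ - 1‖ ≤ L * ‖ξ‖ ^ γ)
    {s : ℝ} (hs : 0 ≤ s) :
    ∃ C > (0 : ℝ), ∀ ξ : EuclideanSpace ℝ (Fin d),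
      (∀ j : ℕ, ‖f ((2 : ℝ) ^ (-(j : ℤ) - 1) • ξ)‖ ≤ 2 ^ s) →
      ∀ᶠ M : ℕ in atTop,
        ‖∏ j ∈ Finset.range M, f ((2 : ℝ) ^ (-(j : ℤ) - 1) • ξ)‖ ≤ C * (1 + ‖ξ‖) ^ s := by
  set r := min δ 1
  have hr : 0 < r := lt_min hδ one_pos
  have hr1 : r ≤ 1 := min_le_right _ _
  set c : ℝ := (1 / 2) ^ γ with hc
  have hc0 : 0 ≤ c := by positivity
  have hc1 : c < 1 := Real.rpow_lt_one (by norm_num) (by norm_num) hγ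
  refine ⟨(2 / r) ^ s * Real.exp (L * (1 - c)⁻¹), by positivity, fun ξ hξ => ?_⟩
  have hx1 : 1 ≤ (1 + ‖ξ‖) / r := by
    rw [one_le_div hr]
    linarith [norm_nonneg ξ]
  obtain ⟨n, hn1, hn2⟩ := exists_nat_pow_near hx1 (one_lt_two (α := ℝ))
  filter_upwards [eventually_ge_atTop (n + 1)] with M hM
  obtain ⟨M, rfl⟩ := Nat.exists_eq_add_of_le hM
  rw [Finset.prod_range_add, norm_mul, norm_prod, norm_prod]
  have hhead : ∏ j ∈ Finset.range (n + 1), ‖f ((2 : ℝ) ^ (-(j : ℤ) - 1) • ξ)‖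
      ≤ (2 / r) ^ s * (1 + ‖ξ‖) ^ s := by
    calc _ ≤ ∏ _j ∈ Finset.range (n + 1), (2 : ℝ) ^ s :=
          Finset.prod_le_prod (fun _ _ => norm_nonneg _) fun j _ => hξ j
      _ = ((2 : ℝ) ^ (n + 1)) ^ s := by
          rw [Finset.prod_const, Finset.card_range, Real.rpow_pow_comm (by norm_num)]
      _ ≤ (2 / r * (1 + ‖ξ‖)) ^ s := by
          refine Real.rpow_le_rpow (by positivity) ?_ hs
          rw [pow_succ]
          calc (2 : ℝ) ^ n * 2 ≤ (1 + ‖ξ‖) / r * 2 := by gcongr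
            _ = _ := by ring
      _ = _ := Real.mul_rpow (by positivity) (by positivity)
  have htail : ∏ i ∈ Finset.range M, ‖f ((2 : ℝ) ^ (-((n + 1 + i : ℕ) : ℤ) - 1) • ξ)‖
      ≤ Real.exp (L * (1 - c)⁻¹) := by
    refine (Finset.prod_le_prod (fun _ _ => norm_nonneg _) fun i _ => ?_).trans
      (prod_one_add_geometric_le hL hc0 hc1 M)
    have hnorm : ‖(2 : ℝ) ^ (-((n + 1 + i : ℕ) : ℤ) - 1) • ξ‖ < r * (1 / 2) ^ i := by
      rw [norm_two_zpow_smul]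
      rw [div_lt_iff₀ hr] at hn2
      calc (1 / 2 : ℝ) ^ (n + 1 + i + 1) * ‖ξ‖
          ≤ (1 / 2 : ℝ) ^ (n + 1 + i) * ‖ξ‖ := by
            gcongr ?_ * ?_
            exact pow_le_pow_of_le_one (by norm_num) (by norm_num) (Nat.le_succ _)
        _ < (1 / 2 : ℝ) ^ (n + 1 + i) * (2 ^ (n + 1) * r) := by
            gcongr
            linarith
        _ = r * (1 / 2) ^ i * ((1 / 2) * 2) ^ (n + 1) := by
            rw [mul_pow, pow_add]
            ring
        _ = r * (1 / 2) ^ i := by norm_num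
    have hpow : (1 / 2 : ℝ) ^ i ≤ 1 := pow_le_one₀ (by norm_num) (by norm_num)
    have hball := hf ((2 : ℝ) ^ (-((n + 1 + i : ℕ) : ℤ) - 1) • ξ) (by
      rw [mem_ball_zero_iff]
      calc _ < r * (1 / 2) ^ i := hnorm
        _ ≤ r * 1 := by gcongr
        _ ≤ δ := by rw [mul_one]; exact min_le_left _ _)
    have hle : ‖(2 : ℝ) ^ (-((n + 1 + i : ℕ) : ℤ) - 1) • ξ‖ ^ γ ≤ c ^ i := by
      rw [hc, Real.rpow_pow_comm (by norm_num)]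
      refine Real.rpow_le_rpow (norm_nonneg _) (hnorm.le.trans ?_) hγ.le
      exact mul_le_of_le_one_left (by positivity) hr1
    calc _ = ‖1 + (f ((2 : ℝ) ^ (-((n + 1 + i : ℕ) : ℤ) - 1) • ξ) - 1)‖ := by
          rw [add_sub_cancel]
      _ ≤ 1 + ‖f ((2 : ℝ) ^ (-((n + 1 + i : ℕ) : ℤ) - 1) • ξ) - 1‖ := by
          simpa using norm_add_le (1 : ℂ) (f ((2 : ℝ) ^ (-((n + 1 + i : ℕ) : ℤ) - 1) • ξ) - 1)
      _ ≤ 1 + L * c ^ i := by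
          gcongr
          exact hball.trans (by gcongr)
  calc _ ≤ ((2 / r) ^ s * (1 + ‖ξ‖) ^ s) * Real.exp (L * (1 - c)⁻¹) := by gcongr
    _ = _ := by ring

end HolderAtZero

lemma ae_forall_dyadic {d : ℕ} {p : EuclideanSpace ℝ (Fin d) → Prop}
    (hp : ∀ᵐ ξ ∂(volume : Measure (EuclideanSpace ℝ (Fin d))), p ξ) :
    ∀ᵐ ξ ∂(volume : Measure (EuclideanSpace ℝ (Fin d))),
      ∀ j : ℕ, p ((2 : ℝ) ^ (-(j : ℤ) - 1) • ξ) := by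
  refine ae_all_iff.mpr fun j => ?_
  exact (Measure.quasiMeasurePreserving_smul volume
    (r := (2 : ℝ) ^ (-(j : ℤ) - 1)) (by positivity)).ae hp

lemma le_two_rpow_self (x : ℝ) : x ≤ 2 ^ x := by
  have hnat (n : ℕ) : (n : ℝ) + 1 ≤ 2 ^ n := by exact_mod_cast Nat.lt_two_pow_self
  rcases le_or_gt x 0 with hx | hx
  · exact hx.trans (by positivity)
  · calc x ≤ (⌊x⌋₊ : ℝ) + 1 := (Nat.lt_floor_add_one x).le
      _ ≤ 2 ^ ⌊x⌋₊ := hnat _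
      _ = 2 ^ (⌊x⌋₊ : ℝ) := (Real.rpow_natCast _ _).symm
      _ ≤ 2 ^ x := Real.rpow_le_rpow_of_exponent_le (by norm_num) (Nat.floor_le hx.le)

/-- If `m = w_N m₀` with `m₀` periodic, a.e. bounded by `C_p`,
Hölder continuous near `0` and `m₀(0) = 1`, then the infinite products
`∏_{j≥1} m(2^{-j} ξ)` converge a.e. to a limit bounded by `C_m (1 + |ξ|)^{-N + 2^{C_p}}`. -/
theorem stmt16 {d : ℕ} (hd : 1 ≤ d)
    (m₀ : EuclideanSpace ℝ (Fin d) → ℂ) (hmeas : Measurable m₀)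
    (hper : ∀ (ξ : EuclideanSpace ℝ (Fin d)) (z : Fin d → ℤ),
      m₀ (ξ + ((WithLp.equiv 2 (Fin d → ℝ)).symm fun k => (z k : ℝ))) = m₀ ξ)
    (hm0 : m₀ 0 = 1)
    (δ γ L : ℝ) (hδ : 0 < δ) (hγ : γ ∈ Set.Ioc (0 : ℝ) 1) (hL : 0 < L)
    (hHolder : ∀ ξ₁ ∈ Metric.ball (0 : EuclideanSpace ℝ (Fin d)) δ,
      ∀ ξ₂ ∈ Metric.ball (0 : EuclideanSpace ℝ (Fin d)) δ,
        ‖m₀ ξ₁ - m₀ ξ₂‖ ≤ L * ‖ξ₁ - ξ₂‖ ^ γ)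
    (Cp : ℝ) (hCp : 0 < Cp)
    (hbd : ∀ᵐ ξ ∂(volume : Measure (EuclideanSpace ℝ (Fin d))), ‖m₀ ξ‖ ≤ Cp)
    (N : ℕ) :
    ∃ φ : EuclideanSpace ℝ (Fin d) → ℂ,
      (∀ᵐ ξ ∂(volume : Measure (EuclideanSpace ℝ (Fin d))),
        Tendsto
          (fun M : ℕ => ∏ j ∈ Finset.range M,
            (wWeight d N ((2 : ℝ) ^ (-(j : ℤ) - 1) • ξ) *
              m₀ ((2 : ℝ) ^ (-(j : ℤ) - 1) • ξ)))
          atTop (𝓝 (φ ξ))) ∧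
      ∃ Cm > (0 : ℝ), ∀ᵐ ξ ∂(volume : Measure (EuclideanSpace ℝ (Fin d))),
        ‖φ ξ‖ ≤ Cm * (1 + ‖ξ‖) ^ (-(N : ℝ) + (2 : ℝ) ^ Cp) := by
  have hf : ∀ ξ ∈ Metric.ball (0 : EuclideanSpace ℝ (Fin d)) δ,
      ‖m₀ ξ - 1‖ ≤ L * ‖ξ‖ ^ γ := fun ξ hξ => by
    simpa [hm0] using hHolder ξ hξ 0 (Metric.mem_ball_self hδ)
  choose p hp using fun ξ => exists_tendsto_prod_of_holder_at_zero hδ hγ.1 hf ξ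
  choose q hq using fun ξ => exists_tendsto_prod_wWeight (d := d) N ξ
  have hlim (ξ : EuclideanSpace ℝ (Fin d)) := (hq ξ).mul (hp ξ)
  simp_rw [← Finset.prod_mul_distrib] at hlim
  obtain ⟨C, hC, hCbd⟩ := exists_eventually_norm_prod_le_of_holder_at_zero hδ hγ.1 hL.le hf
    (s := 2 ^ Cp) (by positivity)
  refine ⟨fun ξ => q ξ * p ξ, .of_forall hlim, (2 ^ d) ^ N * C, by positivity, ?_⟩
  have hCp2 : Cp ≤ 2 ^ (2 : ℝ) ^ Cp := (le_two_rpow_self Cp).trans (le_two_rpow_self _)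
  filter_upwards [ae_forall_dyadic hbd] with ξ hξ
  have hqn := le_of_tendsto (hq ξ).norm (eventually_norm_prod_wWeight_le N ξ)
  have hpn := le_of_tendsto (hp ξ).norm (hCbd ξ fun j => (hξ j).trans hCp2)
  rw [norm_mul, Real.rpow_add (by positivity)]
  calc _ ≤ ((2 ^ d) ^ N * (1 + ‖ξ‖) ^ (-(N : ℝ))) * (C * (1 + ‖ξ‖) ^ (2 : ℝ) ^ Cp) := by gcongr
    _ = _ := by ring
end
end

section
/- Let C ⊆ ℝⁿ be nonempty, closed, convex and orthosymmetric, let x ∈ ℝⁿ, and let p be the nearest-point (Euclidean) projection of x onto C. Then: (i) for every index i, if p_i < 0 then x_i < 0, and if p_i > 0 then x_i > 0; (ii) for every y ∈ C and every s ∈ [−1, 1]ⁿ, the coordinatewise product (s₁·y₁, …, sₙ·yₙ) belongs to C. -/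
open Set

noncomputable section

/-- A convex orthosymmetric set is closed under coordinatewise multiplication by vectors of the
cube `[-1, 1]ⁿ`. -/
theorem Convex.mul_mem_of_orthosymmetric {ι : Type*} [Fintype ι] {C : Set (EuclideanSpace ℝ ι)}
    (hC : Convex ℝ C)
    (hCorth : ∀ x ∈ C, ∀ s : ι → ℝ, (∀ i, s i = 1 ∨ s i = -1) →
      ((WithLp.equiv 2 (ι → ℝ)).symm fun i => s i * x i) ∈ C)
    {y : EuclideanSpace ℝ ι} (hy : y ∈ C) {s : ι → ℝ} (hs : ∀ i, s i ∈ Icc (-1 : ℝ) 1) :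
    ((WithLp.equiv 2 (ι → ℝ)).symm fun i => s i * y i) ∈ C := by
  have hconv : Convex ℝ {t : ι → ℝ | ((WithLp.equiv 2 (ι → ℝ)).symm fun i => t i * y i) ∈ C} := by
    intro t ht u hu a b ha hb hab
    have key := hC ht hu ha hb hab
    rw [mem_ofPred_eq]
    convert key using 1
    ext i
    simp
    ring
  have hcube : s ∈ convexHull ℝ (univ.pi fun _ : ι => ({-1, 1} : Set ℝ)) := by
    rw [convexHull_pi]
    intro i _
    rw [convexHull_pair, segment_eq_Icc (by norm_num)]
    exact hs i
  refine convexHull_min (fun t ht => hCorth y hy t fun i => ?_) hconv hcube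
  simpa [or_comm] using ht i (mem_univ i)

/-- If zeroing the `i`-th coordinate of `p` does not bring it closer to `x`, then
`p i ^ 2 ≤ 2 * (x i * p i)`. -/
theorem EuclideanSpace.sq_le_of_norm_sub_le_zeroed {ι : Type*} [Fintype ι] [DecidableEq ι]
    {x p : EuclideanSpace ℝ ι} {i : ι}
    (h : ‖x - p‖ ≤ ‖x - (WithLp.equiv 2 (ι → ℝ)).symm
      fun j => (if j = i then 0 else 1) * p j‖) :
    p i ^ 2 ≤ 2 * (x i * p i) := by
  have hsq := pow_le_pow_left₀ (norm_nonneg _) h 2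
  rw [EuclideanSpace.real_norm_sq_eq, EuclideanSpace.real_norm_sq_eq,
    ← Finset.add_sum_erase _ _ (Finset.mem_univ i),
    ← Finset.add_sum_erase _ _ (Finset.mem_univ i)] at hsq
  have hrest : ∑ j ∈ Finset.univ.erase i, (x - (WithLp.equiv 2 (ι → ℝ)).symm
      fun j => (if j = i then 0 else 1) * p j) j ^ 2 =
      ∑ j ∈ Finset.univ.erase i, (x - p) j ^ 2 :=
    Finset.sum_congr rfl fun j hj => by simp [Finset.ne_of_mem_erase hj]
  rw [hrest] at hsq
  simp at hsq
  linarith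

/-- Properties of the nearest-point projection onto a nonempty closed convex
orthosymmetric set `C ⊆ ℝⁿ`. -/
theorem stmt17 {n : ℕ} (C : Set (EuclideanSpace ℝ (Fin n)))
    (hCne : C.Nonempty) (hCcl : IsClosed C) (hCconv : Convex ℝ C)
    (hCorth : ∀ x ∈ C, ∀ s : Fin n → ℝ, (∀ i, s i = 1 ∨ s i = -1) →
      ((WithLp.equiv 2 (Fin n → ℝ)).symm fun i => s i * x i) ∈ C)
    (x p : EuclideanSpace ℝ (Fin n))
    (hp : p ∈ C ∧ ∀ y ∈ C, ‖x - p‖ ≤ ‖x - y‖) :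
    (∀ i : Fin n, (p i < 0 → x i < 0) ∧ (0 < p i → 0 < x i)) ∧
    (∀ y ∈ C, ∀ s : Fin n → ℝ, (∀ i, s i ∈ Set.Icc (-1 : ℝ) 1) →
      ((WithLp.equiv 2 (Fin n → ℝ)).symm fun i => s i * y i) ∈ C) := by
  refine ⟨fun i => ?_, fun y hy s hs => hCconv.mul_mem_of_orthosymmetric hCorth hy hs⟩
  have hle : p i ^ 2 ≤ 2 * (x i * p i) :=
    EuclideanSpace.sq_le_of_norm_sub_le_zeroed <| hp.2 _ <|
      hCconv.mul_mem_of_orthosymmetric hCorth hp.1 fun j => by split_ifs <;> norm_num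
  constructor <;> intro hi <;> nlinarith
end
end

section
/- Let a > 0 and let v : (−a, a) → ℂⁿ have real-analytic components, not all identically zero, and let p be the smallest nonnegative integer such that the p-th derivative v^{(p)}(0) ≠ 0. Then lim_{ξ→0} ⟨v(ξ), v(2ξ)⟩ / ‖v(ξ)‖² = 2^p, the limit taken over ξ ≠ 0 with both ξ and 2ξ in (−a, a). -/
open Set Filter Topology

noncomputable section

/-- An analytic function whose derivatives of order less than `p` vanish at `z₀` factors near `z₀`
as `(z - z₀) ^ p • g z`, where `g z₀ ≠ 0` unless the `p`-th derivative vanishes too. -/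
lemma AnalyticAt.exists_eventuallyEq_pow_smul_of_iteratedDeriv_eq_zero {f : ℝ → ℂ} {z₀ : ℝ}
    (hf : AnalyticAt ℝ f z₀) {p : ℕ} (hlow : ∀ k < p, iteratedDeriv k f z₀ = 0) :
    ∃ g : ℝ → ℂ, AnalyticAt ℝ g z₀ ∧ (∀ᶠ z in 𝓝 z₀, f z = (z - z₀) ^ p • g z) ∧
      (iteratedDeriv p f z₀ ≠ 0 → g z₀ ≠ 0) := by
  by_cases hp : iteratedDeriv p f z₀ = 0
  · obtain ⟨g, hg, hfg⟩ := (natCast_le_analyticOrderAt hf).mp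
      ((natCast_le_analyticOrderAt_iff_iteratedDeriv_eq_zero hf).mpr hlow)
    exact ⟨g, hg, hfg, fun h => absurd hp h⟩
  · obtain ⟨g, hg, hg0, hfg⟩ := hf.analyticOrderAt_eq_natCast.mp
      ((analyticOrderAt_eq_nat_iff_iteratedDeriv_eq_zero hf).mpr ⟨hlow, hp⟩)
    exact ⟨g, hg, hfg, fun _ => hg0⟩

/-- If `v : (−a, a) → ℂⁿ` has real-analytic components, not all identically
zero, and `p` is the smallest nonnegative integer with `v^{(p)}(0) ≠ 0`, then
`⟨v(ξ), v(2ξ)⟩ / ‖v(ξ)‖² → 2^p` as `ξ → 0` (over `ξ ≠ 0` with `ξ, 2ξ ∈ (−a, a)`). -/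
theorem stmt19 {n : ℕ} (a : ℝ) (ha : 0 < a)
    (v : Fin n → ℝ → ℂ)
    (hv : ∀ i, ∀ ξ ∈ Set.Ioo (-a) a, AnalyticAt ℝ (v i) ξ)
    (hvne : ∃ i, ∃ ξ ∈ Set.Ioo (-a) a, v i ξ ≠ 0)
    (p : ℕ)
    (hplow : ∀ k : ℕ, k < p → ∀ i, iteratedDeriv k (v i) 0 = 0)
    (hpne : ∃ i, iteratedDeriv p (v i) 0 ≠ 0) :
    Tendsto
      (fun ξ : ℝ =>
        (∑ i, (starRingEnd ℂ) (v i ξ) * v i (2 * ξ)) / ((∑ i, ‖v i ξ‖ ^ 2 : ℝ) : ℂ))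
      (𝓝[{ξ : ℝ | ξ ≠ 0 ∧ ξ ∈ Set.Ioo (-a) a ∧ 2 * ξ ∈ Set.Ioo (-a) a}] 0)
      (𝓝 ((2 : ℂ) ^ p)) := by
  choose g hg hvg hg0 using fun i =>
    (hv i 0 (by simp [ha])).exists_eventuallyEq_pow_smul_of_iteratedDeriv_eq_zero
      (fun k hk => hplow k hk i)
  obtain ⟨j, hj⟩ := hpne
  have hmul : Tendsto (fun ξ : ℝ => 2 * ξ) (𝓝 0) (𝓝 0) :=
    Continuous.tendsto' (by fun_prop) 0 0 (by simp)
  have hnum : Tendsto (fun ξ : ℝ => ∑ i, (starRingEnd ℂ) (g i ξ) * g i (2 * ξ)) (𝓝 0)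
      (𝓝 (∑ i, (starRingEnd ℂ) (g i 0) * g i 0)) :=
    tendsto_finsetSum _ fun i _ =>
      ((Complex.continuous_conj.tendsto _).comp (hg i).continuousAt).mul
        ((hg i).continuousAt.tendsto.comp hmul)
  have hden : Tendsto (fun ξ : ℝ => ((∑ i, ‖g i ξ‖ ^ 2 : ℝ) : ℂ)) (𝓝 0)
      (𝓝 ((∑ i, ‖g i 0‖ ^ 2 : ℝ) : ℂ)) :=
    (Complex.continuous_ofReal.tendsto _).comp <|
      tendsto_finsetSum _ fun i _ => (hg i).continuousAt.norm.tendsto.pow 2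
  have hpos : 0 < ∑ i, ‖g i 0‖ ^ 2 :=
    Finset.sum_pos' (fun i _ => by positivity)
      ⟨j, Finset.mem_univ j, pow_pos (norm_pos_iff.mpr (hg0 j hj)) 2⟩
  have hne : ((∑ i, ‖g i 0‖ ^ 2 : ℝ) : ℂ) ≠ 0 := Complex.ofReal_ne_zero.mpr hpos.ne'
  have hsum : ∑ i, (starRingEnd ℂ) (g i 0) * g i 0 = ((∑ i, ‖g i 0‖ ^ 2 : ℝ) : ℂ) := by
    push_cast
    exact Finset.sum_congr rfl fun i _ => Complex.conj_mul' _
  have hlim := (hnum.div hden hne).const_mul ((2 : ℂ) ^ p)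
  rw [hsum, div_self hne, mul_one] at hlim
  refine (hlim.mono_left nhdsWithin_le_nhds).congr' ?_
  have hvg' : ∀ᶠ ξ in 𝓝 (0 : ℝ), ∀ i, v i ξ = (ξ - 0) ^ p • g i ξ := eventually_all.mpr hvg
  filter_upwards [nhdsWithin_le_nhds hvg', nhdsWithin_le_nhds (hmul.eventually hvg'),
    self_mem_nhdsWithin] with ξ h1 h2 hξ
  have hξp : ((ξ : ℂ) ^ p) ^ 2 ≠ 0 :=
    pow_ne_zero _ (pow_ne_zero _ (Complex.ofReal_ne_zero.mpr hξ.1))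
  have hnum' : ∑ i, (starRingEnd ℂ) (v i ξ) * v i (2 * ξ) =
      ((ξ : ℂ) ^ p) ^ 2 * (2 ^ p * ∑ i, (starRingEnd ℂ) (g i ξ) * g i (2 * ξ)) := by
    simp only [Finset.mul_sum]
    refine Finset.sum_congr rfl fun i _ => ?_
    simp only [h1, h2, sub_zero, Complex.real_smul, map_mul, Complex.conj_ofReal]
    push_cast
    ring
  have hden' : ((∑ i, ‖v i ξ‖ ^ 2 : ℝ) : ℂ) =
      ((ξ : ℂ) ^ p) ^ 2 * ((∑ i, ‖g i ξ‖ ^ 2 : ℝ) : ℂ) := by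
    have hreal : ∑ i, ‖v i ξ‖ ^ 2 = (ξ ^ p) ^ 2 * ∑ i, ‖g i ξ‖ ^ 2 := by
      simp only [h1, sub_zero, norm_smul, mul_pow, Real.norm_eq_abs, sq_abs, Finset.mul_sum]
    rw [hreal]
    push_cast
    rfl
  rw [hnum', hden', mul_div_mul_left _ _ hξp, mul_div_assoc]
  rfl
end
end
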